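/- arXiv:1202.0952 — 2 statements merged into one kernel-verified Lean document; each statement's English description precedes it below -/
import Mathlib

section
/- Let (Ω, 𝒢, (𝒢_t)_{t≥0}, ℙ) be a filtered probability space and (Y_t)_{t≥0} a (𝒢_t)-adapted process with values in an unbounded subset of [0,∞). Let a > 0 and T_a := inf{t ≥ 0 : Y_t ≤ a}. Suppose there exist constants c₁ > 0, c₂ > 0 and r > 1 such that (i) the process (Y_{t∧T_a} + c₁·(t∧T_a))_{t≥0} is a submartingale (i.e. E(dY_t | 𝒢_{t−}) ≥ −c₁ dt on {T_a > t}); and (ii) the process (Y_{t∧T_a}^r − c₂·∫_0^{t∧T_a} Y_s^{r−1} ds)_{t≥0} is a supermartingale (i.e. E(dY_t^r | 𝒢_{t−}) ≤ c₂·Y_{t−}^{r−1} dt on {T_a > t}). Then for every α ∈ (0,1) there exist ε > 0 and δ > 0 such that for all t > 0, ℙ(T_a > t + ε·Y_{t∧T_a} | 𝒢_t) ≥ 1 − α almost surely on the event {T_a > t, Y_t > a(1+δ)}. -/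
open MeasureTheory Set Filter
open scoped ENNReal NNReal

/-- The hitting time `inf {t ≥ 0 : Y_t ≤ c}` (valued in `ℝ≥0∞`, infinite if
the level `c` is never reached). -/
noncomputable def hitTime {Ω : Type*} (Y : ℝ≥0 → Ω → ℝ) (c : ℝ) (ω : Ω) : ℝ≥0∞ :=
  sInf ((fun s : ℝ≥0 => (s : ℝ≥0∞)) '' {s : ℝ≥0 | Y s ω ≤ c})

/-- The stopped time `t ∧ T` where `T = hitTime Y c`. -/
noncomputable def stopAt {Ω : Type*} (Y : ℝ≥0 → Ω → ℝ) (c : ℝ) (t : ℝ≥0) (ω : Ω) : ℝ≥0 :=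
  (min (t : ℝ≥0∞) (hitTime Y c ω)).toNNReal

/-- A process has right-continuous paths. -/
def RightCts {Ω : Type*} (Y : ℝ≥0 → Ω → ℝ) : Prop :=
  ∀ (ω : Ω) (t : ℝ≥0), Filter.Tendsto (fun s => Y s ω) (nhdsWithin t (Set.Ici t)) (nhds (Y t ω))

lemma convex_gap (r : ℝ) (hr : 1 < r) : ∃ g : ℝ, 0 < g ∧ ∀ z η : ℝ, 0 ≤ z → 0 < η →
    (0 ≤ z ^ r - η ^ r - r * η ^ (r - 1) * (z - η)) ∧
    ((z ≤ η / 2 ∨ 2 * η ≤ z) → g * η ^ r ≤ z ^ r - η ^ r - r * η ^ (r - 1) * (z - η)) := by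
  -- tangent line inequality
  have tan : ∀ z η : ℝ, 0 ≤ z → 0 < η → 0 ≤ z ^ r - η ^ r - r * η ^ (r - 1) * (z - η) := by
    intro z η hz hη
    have h := one_add_mul_self_le_rpow_one_add (s := z / η - 1)
      (by have := div_nonneg hz hη.le; linarith) hr.le
    have e : (1 + (z / η - 1)) ^ r = z ^ r / η ^ r := by
      rw [← Real.div_rpow hz hη.le]; congr 1; ring
    rw [e] at h
    have hp : 0 < η ^ r := Real.rpow_pos_of_pos hη r
    rw [le_div_iff₀ hp] at h
    have e2 : η ^ (r - 1) = η ^ r / η := by rw [Real.rpow_sub_one hη.ne']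
    rw [e2]
    have : (1 + r * (z / η - 1)) * η ^ r = η ^ r + r * (η ^ r / η) * (z - η) := by
      field_simp
    linarith
  have b1 : 0 < (1 / 2 : ℝ) ^ r - 1 + r / 2 := by
    have := one_add_mul_self_lt_rpow_one_add (s := -(1 / 2 : ℝ)) (by norm_num) (by norm_num) hr
    norm_num at this ⊢
    linarith
  have b2 : 0 < (2 : ℝ) ^ r - 1 - r := by
    have := one_add_mul_self_lt_rpow_one_add (s := (1 : ℝ)) (by norm_num) (by norm_num) hr
    norm_num at this ⊢
    linarith
  refine ⟨min ((1 / 2 : ℝ) ^ r - 1 + r / 2) ((2 : ℝ) ^ r - 1 - r), lt_min b1 b2, ?_⟩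
  intro z η hz hη
  refine ⟨tan z η hz hη, fun hzη => ?_⟩
  have hp : 0 < η ^ r := Real.rpow_pos_of_pos hη r
  have hp1 : 0 < η ^ (r - 1) := Real.rpow_pos_of_pos hη _
  have e2 : η ^ r = η ^ (r - 1) * η := by
    rw [Real.rpow_sub_one hη.ne']; field_simp
  rcases hzη with h | h
  · have t := tan z (η / 2) hz (by linarith)
    have e3 : (η / 2) ^ r = (1 / 2 : ℝ) ^ r * η ^ r := by
      rw [← Real.mul_rpow (by norm_num) hη.le]; congr 1; ring
    have e4 : (η / 2) ^ (r - 1) ≤ η ^ (r - 1) :=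
      Real.rpow_le_rpow (by linarith) (by linarith) (by linarith)
    have m : min ((1 / 2 : ℝ) ^ r - 1 + r / 2) ((2 : ℝ) ^ r - 1 - r) * η ^ r
        ≤ ((1 / 2 : ℝ) ^ r - 1 + r / 2) * η ^ r :=
      mul_le_mul_of_nonneg_right (min_le_left _ _) hp.le
    rw [e3] at t
    have : 0 ≤ r * (η ^ (r - 1) - (η / 2) ^ (r - 1)) * (η / 2 - z) :=
      mul_nonneg (mul_nonneg (by linarith) (by linarith)) (by linarith)
    have e5 : ((1 / 2 : ℝ) ^ r - 1 + r / 2) * η ^ r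
      = (1 / 2 : ℝ) ^ r * η ^ r - η ^ r + r / 2 * (η ^ (r - 1) * η) := by rw [← e2]; ring
    rw [e5] at m
    nlinarith
  · have t := tan z (2 * η) hz (by linarith)
    have e3 : (2 * η) ^ r = (2 : ℝ) ^ r * η ^ r := by
      rw [← Real.mul_rpow (by norm_num) hη.le]
    have e4 : η ^ (r - 1) ≤ (2 * η) ^ (r - 1) :=
      Real.rpow_le_rpow (by linarith) (by linarith) (by linarith)
    have m : min ((1 / 2 : ℝ) ^ r - 1 + r / 2) ((2 : ℝ) ^ r - 1 - r) * η ^ r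
        ≤ ((2 : ℝ) ^ r - 1 - r) * η ^ r :=
      mul_le_mul_of_nonneg_right (min_le_right _ _) hp.le
    rw [e3] at t
    have : 0 ≤ r * ((2 * η) ^ (r - 1) - η ^ (r - 1)) * (z - 2 * η) :=
      mul_nonneg (mul_nonneg (by linarith) (by linarith)) (by linarith)
    have e5 : ((2 : ℝ) ^ r - 1 - r) * η ^ r
      = (2 : ℝ) ^ r * η ^ r - η ^ r - r * (η ^ (r - 1) * η) := by rw [← e2]; ring
    rw [e5] at m
    nlinarith

/-- The hitting time is attained. -/
lemma hit_attained {Ω : Type*} {Y : ℝ≥0 → Ω → ℝ} (hrc : RightCts Y) {a : ℝ} {ω : Ω}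
    {τ : ℝ≥0} (h : hitTime Y a ω = τ) : Y τ ω ≤ a := by
  by_contra hlt
  push Not at hlt
  have ev := (hrc ω τ).eventually (lt_mem_nhds hlt)
  rw [eventually_nhdsWithin_iff, Metric.eventually_nhds_iff] at ev
  obtain ⟨κ, hκ, hev⟩ := ev
  have : (τ : ℝ≥0∞) < ((τ + κ.toNNReal : ℝ≥0) : ℝ≥0∞) := by
    have : 0 < κ.toNNReal := Real.toNNReal_pos.mpr hκ
    exact_mod_cast lt_add_of_pos_right τ this
  rw [← h, hitTime, sInf_lt_iff] at this
  obtain ⟨_, ⟨u, hu, rfl⟩, hu2⟩ := this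
  have h1 : τ ≤ u := by
    have : hitTime Y a ω ≤ u := sInf_le ⟨u, hu, rfl⟩
    rw [h] at this; exact_mod_cast this
  have h2 : u < τ + κ.toNNReal := by
    have := hu2
    rw [ENNReal.coe_lt_coe] at this; exact this
  have h3 : dist u τ < κ := by
    rw [NNReal.dist_eq, abs_of_nonneg (by simpa using h1)]
    have : (u : ℝ) < τ + κ.toNNReal := by exact_mod_cast h2
    rw [Real.coe_toNNReal _ hκ.le] at this; linarith
  exact absurd (hev h3 h1) (not_lt.mpr hu)

lemma stopAt_of_le {Ω : Type*} {Y : ℝ≥0 → Ω → ℝ} {a : ℝ} {ω : Ω}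
    {u : ℝ≥0} (h : (u : ℝ≥0∞) ≤ hitTime Y a ω) : stopAt Y a u ω = u := by
  simp [stopAt, min_eq_left h]

lemma stopAt_le {Ω : Type*} {Y : ℝ≥0 → Ω → ℝ} {a : ℝ} {ω : Ω}
    {u : ℝ≥0} : stopAt Y a u ω ≤ u := by
  rw [stopAt]
  have := ENNReal.toNNReal_mono ENNReal.coe_ne_top (min_le_left (u : ℝ≥0∞) (hitTime Y a ω))
  simpa using this

lemma coe_stopAt {Ω : Type*} {Y : ℝ≥0 → Ω → ℝ} {a : ℝ} {ω : Ω}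
    {u : ℝ≥0} (h : hitTime Y a ω ≤ u) : hitTime Y a ω = stopAt Y a u ω := by
  rw [stopAt, min_eq_right h, ENNReal.coe_toNNReal (ne_top_of_le_ne_top ENNReal.coe_ne_top h)]

lemma stopAt_val {Ω : Type*} {Y : ℝ≥0 → Ω → ℝ} (hrc : RightCts Y) {a : ℝ} {ω : Ω}
    {u : ℝ≥0} (h : hitTime Y a ω ≤ u) : Y (stopAt Y a u ω) ω ≤ a :=
  hit_attained hrc (coe_stopAt h)

lemma lt_hit_pos {Ω : Type*} {Y : ℝ≥0 → Ω → ℝ} {a : ℝ} {ω : Ω}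
    {u : ℝ≥0} (h : (u : ℝ≥0∞) < hitTime Y a ω) : a < Y u ω := by
  by_contra hc
  exact absurd h (not_lt.mpr (sInf_le ⟨u, not_lt.mp hc, rfl⟩))

/-- `{T > u}` is `𝒢 u`-measurable. -/
lemma meas_lt_hit {Ω : Type*} {m : MeasurableSpace Ω}
    (𝒢 : MeasureTheory.Filtration ℝ≥0 m)
    {Y : ℝ≥0 → Ω → ℝ} (hadp : MeasureTheory.Adapted 𝒢 Y) (hrc : RightCts Y)
    {a c₁ : ℝ} (hc₁ : 0 < c₁)
    (hU : StronglyAdapted 𝒢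
      (fun (t : ℝ≥0) (ω : Ω) => Y (stopAt Y a t ω) ω + c₁ * ((stopAt Y a t ω : ℝ≥0) : ℝ)))
    (u : ℝ≥0) : MeasurableSet[𝒢 u] {ω | (u : ℝ≥0∞) < hitTime Y a ω} := by
  have e : {ω | (u : ℝ≥0∞) < hitTime Y a ω} = {ω | a < Y u ω} ∩
      {ω | Y (stopAt Y a u ω) ω + c₁ * ((stopAt Y a u ω : ℝ≥0) : ℝ) = Y u ω + c₁ * (u : ℝ)} := by
    ext ω
    simp only [mem_ofPred_eq, mem_inter_iff]
    constructor
    · intro h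
      exact ⟨lt_hit_pos h, by rw [stopAt_of_le h.le]⟩
    · rintro ⟨h1, h2⟩
      by_contra hc
      have hc := not_lt.mp hc
      have h3 := stopAt_val hrc hc
      have h4 : ((stopAt Y a u ω : ℝ≥0) : ℝ) ≤ u := NNReal.coe_le_coe.mpr stopAt_le
      nlinarith
  rw [e]
  have hY : Measurable[𝒢 u] (Y u) := hadp u
  exact MeasurableSet.inter (measurableSet_lt measurable_const hY)
    (measurableSet_eq_fun (hU u).measurable (hY.add_const _))

lemma int_incr (f : ℝ → ℝ) (hf : ∀ x, 0 ≤ f x) {p q B : ℝ} (hp : 0 ≤ p) (hpq : p ≤ q)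
    (hB : ∀ x, p < x → x < q → f x ≤ B) :
    (∫ x in Set.Ioc 0 q, f x) - (∫ x in Set.Ioc 0 p, f x) ≤ (q - p) * B := by
  rcases hpq.eq_or_lt with rfl | hlt
  · simp
  have hB0 : 0 ≤ B := (hf ((p + q) / 2)).trans (hB _ (by linarith) (by linarith))
  by_cases hi : IntegrableOn f (Set.Ioc 0 q)
  · have h1 : IntegrableOn f (Set.Ioc 0 p) := hi.mono_set (Ioc_subset_Ioc_right hpq)
    have h2 : IntegrableOn f (Set.Ioc p q) := hi.mono_set (Ioc_subset_Ioc_left hp)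
    rw [← Ioc_union_Ioc_eq_Ioc hp hpq, setIntegral_union (Ioc_disjoint_Ioc_of_le le_rfl)
      measurableSet_Ioc h1 h2, add_sub_cancel_left, integral_Ioc_eq_integral_Ioo]
    have h3 : IntegrableOn f (Set.Ioo p q) := h2.mono_set Ioo_subset_Ioc_self
    calc ∫ x in Set.Ioo p q, f x ≤ ∫ x in Set.Ioo p q, B :=
          setIntegral_mono_on h3 (by simp) measurableSet_Ioo (fun x hx => hB x hx.1 hx.2)
      _ = (q - p) * B := by simp [hpq]
  · rw [integral_undef hi]
    have : 0 ≤ ∫ x in Set.Ioc 0 p, f x := integral_nonneg hf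
    have : 0 ≤ (q - p) * B := mul_nonneg (by linarith) hB0
    linarith

/-- The supermartingale of the hypothesis. -/
noncomputable def XX {Ω : Type*} (Y : ℝ≥0 → Ω → ℝ) (a c₂ r : ℝ) (t : ℝ≥0) (ω : Ω) : ℝ :=
  Y (stopAt Y a t ω) ω ^ r
        - c₂ * ∫ s in Set.Ioc (0:ℝ) ((stopAt Y a t ω : ℝ≥0) : ℝ), Y s.toNNReal ω ^ (r - 1)

/-- The submartingale of the hypothesis. -/
noncomputable def UU {Ω : Type*} (Y : ℝ≥0 → Ω → ℝ) (a c₁ : ℝ) (t : ℝ≥0) (ω : Ω) : ℝ :=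
  Y (stopAt Y a t ω) ω + c₁ * ((stopAt Y a t ω : ℝ≥0) : ℝ)

lemma stopAt_ge {Ω : Type*} {Y : ℝ≥0 → Ω → ℝ} {a : ℝ} {ω : Ω}
    {t u : ℝ≥0} (h : (t : ℝ≥0∞) ≤ hitTime Y a ω) (htu : t ≤ u) : t ≤ stopAt Y a u ω := by
  rcases le_total (u : ℝ≥0∞) (hitTime Y a ω) with h1 | h1
  · rw [stopAt_of_le h1]; exact htu
  · rw [coe_stopAt h1] at h; exact_mod_cast h

/-- Pathwise bounds. -/
lemma path_bound {Ω : Type*} {Y : ℝ≥0 → Ω → ℝ} (hrc : RightCts Y) (hY0 : ∀ t ω, 0 ≤ Y t ω)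
    {a c₁ c₂ r g : ℝ} (ha : 0 < a) (hc₁ : 0 < c₁) (hc₂ : 0 < c₂) (hr : 1 < r) (hg : 0 < g)
    (hgap : ∀ z η : ℝ, 0 ≤ z → 0 < η →
      (0 ≤ z ^ r - η ^ r - r * η ^ (r - 1) * (z - η)) ∧
      ((z ≤ η / 2 ∨ 2 * η ≤ z) → g * η ^ r ≤ z ^ r - η ^ r - r * η ^ (r - 1) * (z - η)))
    {ω : Ω} {t d : ℝ≥0} (hd : 0 < d) (ht : (t : ℝ≥0∞) < hitTime Y a ω)
    {y : ℝ} (hya : 2 * a ≤ y) (hy1 : y ≤ Y t ω) (hy2 : Y t ω < 2 * y) {c : ℝ}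
    (hc : c = 2 * c₂ * d * (4 * y) ^ (r - 1) + r * (2 * y) ^ (r - 1) * c₁ * d) :
    let Hd : ℝ≥0 → ℝ := fun v => (XX Y a c₂ r v ω - XX Y a c₂ r t ω)
      - r * (Y t ω) ^ (r - 1) * (UU Y a c₁ v ω - UU Y a c₁ t ω)
    (- c ≤ Hd (t + d) ∧ (hitTime Y a ω ≤ ((t + d : ℝ≥0) : ℝ≥0∞) → g * y ^ r - c ≤ Hd (t + d))) ∨
    ∃ u : ℝ≥0, t ≤ u ∧ u ≤ t + d ∧ ∃ κ : ℝ, 0 < κ ∧ ∀ v : ℝ≥0, u ≤ v → v ≤ t + d →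
      (v : ℝ) < u + κ → g * y ^ r - c ≤ Hd v := by
  intro Hd
  have hy : 0 < y := by linarith
  have hη : 0 < Y t ω := by linarith
  set F : ℝ → ℝ := fun s => Y s.toNNReal ω ^ (r - 1) with hF
  have hF0 : ∀ x, 0 ≤ F x := fun x => Real.rpow_nonneg (hY0 _ _) _
  set I : ℝ≥0 → ℝ := fun v => ∫ s in Set.Ioc (0:ℝ) (v : ℝ), F s with hI
  have hst : stopAt Y a t ω = t := stopAt_of_le ht.le
  -- basic lower bound
  have P0 : ∀ v : ℝ≥0, t ≤ v → v ≤ t + d →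
      I (stopAt Y a v ω) - I t ≤ 2 * (d * (4 * y) ^ (r - 1)) →
      Y (stopAt Y a v ω) ω ^ r - Y t ω ^ r - r * Y t ω ^ (r - 1) * (Y (stopAt Y a v ω) ω - Y t ω)
        - c ≤ Hd v := by
    intro v htv hv hIv
    have e : Hd v = Y (stopAt Y a v ω) ω ^ r - Y t ω ^ r
        - r * Y t ω ^ (r - 1) * (Y (stopAt Y a v ω) ω - Y t ω)
        - c₂ * (I (stopAt Y a v ω) - I t)
        - r * Y t ω ^ (r - 1) * c₁ * ((stopAt Y a v ω : ℝ≥0) - (t : ℝ)) := by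
      simp only [Hd, XX, UU, hst, hI, hF]; ring
    rw [e, hc]
    have h1 : c₂ * (I (stopAt Y a v ω) - I t) ≤ c₂ * (2 * (d * (4 * y) ^ (r - 1))) :=
      mul_le_mul_of_nonneg_left hIv hc₂.le
    have h2 : ((stopAt Y a v ω : ℝ≥0) : ℝ) - t ≤ d := by
      have : ((stopAt Y a v ω : ℝ≥0) : ℝ) ≤ ((t + d : ℝ≥0) : ℝ) :=
        NNReal.coe_le_coe.mpr (stopAt_le.trans hv)
      push_cast at this; linarith
    have h3 : Y t ω ^ (r - 1) ≤ (2 * y) ^ (r - 1) :=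
      Real.rpow_le_rpow hη.le hy2.le (by linarith)
    have h4 : 0 ≤ Y t ω ^ (r - 1) := Real.rpow_nonneg hη.le _
    have h5 : r * Y t ω ^ (r - 1) * c₁ * (((stopAt Y a v ω : ℝ≥0) : ℝ) - t)
        ≤ r * (2 * y) ^ (r - 1) * c₁ * d := by
      have : r * Y t ω ^ (r - 1) * c₁ * (((stopAt Y a v ω : ℝ≥0) : ℝ) - t)
        ≤ r * Y t ω ^ (r - 1) * c₁ * d := mul_le_mul_of_nonneg_left h2 (by positivity)
      refine this.trans ?_
      gcongr
    linarith
  have hyr : g * y ^ r ≤ g * Y t ω ^ r :=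
    mul_le_mul_of_nonneg_left (Real.rpow_le_rpow hy.le hy1 (by linarith)) hg.le
  have hpos4 : 0 < (4 * y) ^ (r - 1) := Real.rpow_pos_of_pos (by linarith) _
  have hdR : 0 < (d : ℝ) := hd
  by_cases hex : ∃ u : ℝ≥0, t ≤ u ∧ u ≤ t + d ∧ 4 * y < Y (stopAt Y a u ω) ω
  · right
    -- such a `u` is before the hitting time
    have key : ∀ u : ℝ≥0, 4 * y < Y (stopAt Y a u ω) ω →
        (u : ℝ≥0∞) < hitTime Y a ω ∧ 4 * y < Y u ω := by
      intro u hu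
      have : (u : ℝ≥0∞) < hitTime Y a ω := by
        by_contra hcon
        have := stopAt_val hrc (not_lt.mp hcon)
        linarith
      refine ⟨this, ?_⟩
      rwa [stopAt_of_le this.le] at hu
    set E : Set ℝ≥0 := {u | t ≤ u ∧ u ≤ t + d ∧ 4 * y < Y (stopAt Y a u ω) ω} with hE
    have hEne : E.Nonempty := hex
    have hbd : BddBelow E := ⟨t, fun u hu => hu.1⟩
    set ρ := sInf E with hρ
    have htρ : t ≤ ρ := le_csInf hEne fun u hu => hu.1
    have hρd : ρ ≤ t + d := by
      obtain ⟨u, hu⟩ := hEne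
      exact (csInf_le hbd hu).trans hu.2.1
    -- integral up to ρ
    have hIρ : I ρ - I t ≤ (ρ - t) * (4 * y) ^ (r - 1) := by
      refine int_incr F hF0 t.2 (NNReal.coe_le_coe.mpr htρ) ?_
      intro x hx1 hx2
      refine Real.rpow_le_rpow (hY0 _ _) ?_ (by linarith)
      by_contra hcon
      push Not at hcon
      have hx0 : 0 ≤ x := t.2.trans hx1.le
      have hxc : ((x.toNNReal : ℝ≥0) : ℝ) = x := Real.coe_toNNReal _ hx0
      have hxρ : x.toNNReal < ρ := by rw [← NNReal.coe_lt_coe, hxc]; exact hx2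
      have hxt : t ≤ x.toNNReal := by rw [← NNReal.coe_le_coe, hxc]; exact hx1.le
      have hxT : (x.toNNReal : ℝ≥0∞) ≤ hitTime Y a ω := by
        obtain ⟨u, hu⟩ := hEne
        have h1 := (key u hu.2.2).1
        have h2 : x.toNNReal ≤ u := hxρ.le.trans (csInf_le hbd hu)
        exact (ENNReal.coe_le_coe.mpr h2).trans h1.le
      have : x.toNNReal ∈ E := ⟨hxt, hxρ.le.trans hρd, by rw [stopAt_of_le hxT]; exact hcon⟩
      exact absurd (csInf_le hbd this) (not_le.mpr hxρ)
    -- local bound to the right of ρ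
    have ev := (hrc ω ρ).eventually (gt_mem_nhds (show Y ρ ω < Y ρ ω + 1 by linarith))
    rw [eventually_nhdsWithin_iff, Metric.eventually_nhds_iff] at ev
    obtain ⟨κ₁, hκ₁, hev⟩ := ev
    set B : ℝ := (Y ρ ω + 1) ^ (r - 1) with hBdef
    have hB : 0 < B := Real.rpow_pos_of_pos (by have := hY0 ρ ω; linarith) _
    set θ : ℝ := min κ₁ (d * (4 * y) ^ (r - 1) / B) with hθ
    have hθ0 : 0 < θ := lt_min hκ₁ (by positivity)
    have hIv : ∀ v : ℝ≥0, ρ ≤ v → (v : ℝ) < ρ + θ → I v - I t ≤ 2 * (d * (4 * y) ^ (r - 1)) := by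
      intro v hv1 hv2
      have h1 : I v - I ρ ≤ (v - ρ) * B := by
        refine int_incr F hF0 ρ.2 (NNReal.coe_le_coe.mpr hv1) ?_
        intro x hx1 hx2
        have hx0 : 0 ≤ x := ρ.2.trans hx1.le
        have hxc : ((x.toNNReal : ℝ≥0) : ℝ) = x := Real.coe_toNNReal _ hx0
        refine Real.rpow_le_rpow (hY0 _ _) ?_ (by linarith)
        refine (hev (y := x.toNNReal) ?_ ?_).le
        · rw [NNReal.dist_eq, hxc, abs_of_nonneg (by linarith)]
          have := min_le_left κ₁ (d * (4 * y) ^ (r - 1) / B)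
          linarith
        · rw [mem_Ici, ← NNReal.coe_le_coe, hxc]; exact hx1.le
      have h2 : (v - ρ) * B ≤ d * (4 * y) ^ (r - 1) := by
        rw [← le_div_iff₀ hB]
        have := min_le_right κ₁ (d * (4 * y) ^ (r - 1) / B)
        linarith
      have h3 : ((ρ : ℝ) - t) * (4 * y) ^ (r - 1) ≤ d * (4 * y) ^ (r - 1) := by
        refine mul_le_mul_of_nonneg_right ?_ hpos4.le
        have : (ρ : ℝ) ≤ ((t + d : ℝ≥0) : ℝ) := NNReal.coe_le_coe.mpr hρd
        push_cast at this; linarith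
      linarith
    -- pick a point close to ρ
    obtain ⟨u, huE, hu⟩ : ∃ u ∈ E, u < ρ + θ.toNNReal :=
      exists_lt_of_csInf_lt hEne (lt_add_of_pos_right _ (Real.toNNReal_pos.mpr hθ0))
    have huθ : (u : ℝ) < ρ + θ := by
      have : (u : ℝ) < ((ρ + θ.toNNReal : ℝ≥0) : ℝ) := NNReal.coe_lt_coe.mpr hu
      push_cast at this
      rwa [Real.coe_toNNReal _ hθ0.le] at this
    have hρu : ρ ≤ u := csInf_le hbd huE
    obtain ⟨huT, hu4⟩ := key u huE.2.2
    have ev := (hrc ω u).eventually (lt_mem_nhds hu4)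
    rw [eventually_nhdsWithin_iff, Metric.eventually_nhds_iff] at ev
    obtain ⟨κ₂, hκ₂, hev2⟩ := ev
    refine ⟨u, huE.1, huE.2.1, min κ₂ (ρ + θ - u), lt_min hκ₂ (by linarith), ?_⟩
    have h4 : ∀ v : ℝ≥0, u ≤ v → (v : ℝ) < u + min κ₂ (ρ + θ - u) → 4 * y < Y v ω := by
      intro v hv1 hv2
      have hvR : (u : ℝ) ≤ v := NNReal.coe_le_coe.mpr hv1
      refine hev2 ?_ hv1
      rw [NNReal.dist_eq, abs_of_nonneg (by linarith)]
      have := min_le_left κ₂ (ρ + θ - u)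
      linarith
    intro v huv hv hvκ
    have hvR : (u : ℝ) ≤ v := NNReal.coe_le_coe.mpr huv
    have hvT : (v : ℝ≥0∞) ≤ hitTime Y a ω := by
      refine le_sInf ?_
      rintro _ ⟨x, hx, rfl⟩
      by_contra hcon
      have hxv : x < v := by
        have := not_le.mp hcon
        simpa using this
      have hux : u ≤ x := by
        have : hitTime Y a ω ≤ x := sInf_le ⟨x, hx, rfl⟩
        have := huT.trans_le this
        exact_mod_cast this.le
      have := h4 x hux ((NNReal.coe_lt_coe.mpr hxv).trans hvκ)
      have hx : Y x ω ≤ a := hx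
      linarith
    have hsv := stopAt_of_le hvT
    have := P0 v (huE.1.trans huv) hv (by
      rw [hsv]
      refine hIv v (hρu.trans huv) ?_
      have := min_le_right κ₂ (ρ + θ - u)
      linarith)
    rw [hsv] at this
    have hg2 := (hgap (Y v ω) (Y t ω) (hY0 _ _) hη).2 (Or.inr (by
      have := h4 v huv hvκ; linarith))
    linarith
  · left
    push Not at hex
    have hts : t ≤ stopAt Y a (t + d) ω := stopAt_ge ht.le le_self_add
    have hIs : I (stopAt Y a (t + d) ω) - I t
        ≤ (((stopAt Y a (t + d) ω : ℝ≥0) : ℝ) - t) * (4 * y) ^ (r - 1) := by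
      refine int_incr F hF0 t.2 (NNReal.coe_le_coe.mpr hts) ?_
      intro x hx1 hx2
      have hx0 : 0 ≤ x := t.2.trans hx1.le
      have hxc : ((x.toNNReal : ℝ≥0) : ℝ) = x := Real.coe_toNNReal _ hx0
      refine Real.rpow_le_rpow (hY0 _ _) ?_ (by linarith)
      have hxs : x.toNNReal ≤ stopAt Y a (t + d) ω := by
        rw [← NNReal.coe_le_coe, hxc]; exact hx2.le
      have hxt : t ≤ x.toNNReal := by rw [← NNReal.coe_le_coe, hxc]; exact hx1.le
      have hxT : (x.toNNReal : ℝ≥0∞) ≤ hitTime Y a ω := by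
        rcases le_total ((t + d : ℝ≥0) : ℝ≥0∞) (hitTime Y a ω) with h1 | h1
        · exact (ENNReal.coe_le_coe.mpr (hxs.trans stopAt_le)).trans h1
        · rw [coe_stopAt h1]; exact ENNReal.coe_le_coe.mpr hxs
      have := hex x.toNNReal hxt (hxs.trans stopAt_le)
      rwa [stopAt_of_le hxT] at this
    have h3 : (((stopAt Y a (t + d) ω : ℝ≥0) : ℝ) - t) * (4 * y) ^ (r - 1)
        ≤ d * (4 * y) ^ (r - 1) := by
      refine mul_le_mul_of_nonneg_right ?_ hpos4.le
      have : ((stopAt Y a (t + d) ω : ℝ≥0) : ℝ) ≤ ((t + d : ℝ≥0) : ℝ) :=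
        NNReal.coe_le_coe.mpr stopAt_le
      push_cast at this; linarith
    have h4 : 0 < d * (4 * y) ^ (r - 1) := by positivity
    have p := P0 (t + d) le_self_add le_rfl (by linarith)
    have hg1 := hgap (Y (stopAt Y a (t + d) ω) ω) (Y t ω) (hY0 _ _) hη
    refine ⟨by linarith [hg1.1], fun hT => ?_⟩
    have := hg1.2 (Or.inl (by have := stopAt_val hrc hT; linarith))
    linarith

lemma weighted_sub {Ω : Type*} {m : MeasurableSpace Ω}
    {𝒢 : MeasureTheory.Filtration ℝ≥0 m} {ℙ : Measure Ω} [IsProbabilityMeasure ℙ]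
    {U : ℝ≥0 → Ω → ℝ} (hU : Submartingale U 𝒢 ℙ) {u v : ℝ≥0} (huv : u ≤ v)
    {w : Ω → ℝ} (hw : StronglyMeasurable[𝒢 u] w) {K : ℝ} (hw0 : ∀ ω, 0 ≤ w ω)
    (hwK : ∀ ω, w ω ≤ K) {E : Set Ω} (hE : MeasurableSet[𝒢 u] E) :
    ∫ ω in E, w ω * U u ω ∂ℙ ≤ ∫ ω in E, w ω * U v ω ∂ℙ := by
  have hb : ∀ᵐ ω ∂ℙ, ‖w ω‖ ≤ K := Eventually.of_forall fun ω => by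
    rw [Real.norm_eq_abs, abs_of_nonneg (hw0 ω)]; exact hwK ω
  have hwm : AEStronglyMeasurable w ℙ := (hw.mono (𝒢.le u)).aestronglyMeasurable
  have hiu : Integrable (fun ω => w ω * U u ω) ℙ := (hU.integrable u).bdd_mul hwm hb
  have hiv : Integrable (w * U v) ℙ := (hU.integrable v).bdd_mul hwm hb
  have e : ∫ ω in E, w ω * U v ω ∂ℙ = ∫ ω in E, (ℙ[w * U v | 𝒢 u]) ω ∂ℙ :=
    (setIntegral_condExp (𝒢.le u) hiv hE).symm
  rw [e]
  refine setIntegral_mono_ae hiu.integrableOn integrable_condExp.integrableOn ?_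
  have h1 := condExp_mul_of_aestronglyMeasurable_left (m := 𝒢 u) hw.aestronglyMeasurable hiv
    (hU.integrable v)
  filter_upwards [h1, hU.2.1 u v huv] with ω h2 h3
  rw [h2]
  exact mul_le_mul_of_nonneg_left h3 (hw0 ω)

open Classical in
lemma disc_max {Ω : Type*} {m : MeasurableSpace Ω} {ℙ : Measure Ω} [IsProbabilityMeasure ℙ]
    (F : ℕ → MeasurableSpace Ω) (hmono : Monotone F) (hF : ∀ k, F k ≤ m)
    (h : ℕ → Ω → ℝ) (h0 : ∀ ω, h 0 ω = 0) (hi : ∀ k, Integrable (h k) ℙ)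
    (hm : ∀ k, Measurable[F k] (h k)) {D : Set Ω} (hD : MeasurableSet[F 0] D)
    (N : ℕ)
    (hstep : ∀ k < N, ∀ E, MeasurableSet[F k] E → E ⊆ D →
      ∫ ω in E, h (k + 1) ω ∂ℙ ≤ ∫ ω in E, h k ω ∂ℙ) {l : ℝ} (hl : 0 < l) :
    IntegrableOn (fun ω => if ∃ k ≤ N, l ≤ h k ω then l else h N ω) D ℙ ∧
    ∫ ω in D, (if ∃ k ≤ N, l ≤ h k ω then l else h N ω) ∂ℙ ≤ 0 := by
  have hB : ∀ n, MeasurableSet[F n] {ω | ∃ k ≤ n, l ≤ h k ω} := by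
    intro n
    have : {ω | ∃ k ≤ n, l ≤ h k ω} = ⋃ k ∈ Finset.range (n + 1), {ω | l ≤ h k ω} := by
      ext ω; simp
    rw [this]
    refine Finset.measurableSet_biUnion _ fun k hk => ?_
    refine hmono (Nat.lt_succ_iff.mp (Finset.mem_range.mp hk)) _ ?_
    exact measurableSet_le measurable_const (hm k)
  have hint : ∀ n, Integrable (fun ω => if ∃ k ≤ n, l ≤ h k ω then l else h n ω) ℙ := by
    intro n
    have := Integrable.piecewise (hF n _ (hB n)) (integrable_const (μ := ℙ) l).integrableOn
      (hi n).integrableOn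
    refine this.congr (Eventually.of_forall fun ω => ?_)
    by_cases hω : ∃ k ≤ n, l ≤ h k ω
    · have hω' : ω ∈ {ω | ∃ k ≤ n, l ≤ h k ω} := hω
      rw [piecewise_eq_of_mem _ _ _ hω']
      exact (if_pos hω).symm
    · have hω' : ω ∉ {ω | ∃ k ≤ n, l ≤ h k ω} := hω
      rw [piecewise_eq_of_notMem _ _ _ hω']
      exact (if_neg hω).symm
  refine ⟨(hint N).integrableOn, ?_⟩
  induction N with
  | zero =>
    refine le_of_eq (integral_eq_zero_of_ae (Eventually.of_forall fun ω => ?_))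
    have hne : ¬ ∃ k ≤ 0, l ≤ h k ω := by
      rintro ⟨k, hk, hk2⟩
      obtain rfl : k = 0 := by omega
      rw [h0] at hk2; linarith
    exact (if_neg hne).trans (h0 ω)
  | succ n ih =>
    have ih := ih (fun k hk => hstep k (by omega))
    refine le_trans ?_ ih
    set A : Set Ω := {ω | ∃ k ≤ n, l ≤ h k ω}ᶜ with hA
    have hAm : MeasurableSet[F n] A := (hB n).compl
    have hDn : MeasurableSet[F n] D := hmono (Nat.zero_le n) _ hD
    have st := hstep n (by omega) (D ∩ A) (hDn.inter hAm) inter_subset_left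
    have hAm' := hF n _ hAm
    rw [← setIntegral_indicator hAm', ← setIntegral_indicator hAm'] at st
    have i1 : Integrable (A.indicator (h (n + 1))) ℙ := (hi _).indicator hAm'
    have i2 : Integrable (A.indicator (h n)) ℙ := (hi _).indicator hAm'
    have pw : ∀ ω, (if ∃ k ≤ n + 1, l ≤ h k ω then l else h (n + 1) ω)
        + A.indicator (h n) ω ≤
        (if ∃ k ≤ n, l ≤ h k ω then l else h n ω) + A.indicator (h (n + 1)) ω := by
      intro ω
      by_cases hω : ∃ k ≤ n, l ≤ h k ω
      · have : ω ∉ A := by simpa [hA] using hω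
        rw [indicator_of_notMem this, indicator_of_notMem this, if_pos hω, if_pos]
        obtain ⟨k, hk, hk2⟩ := hω
        exact ⟨k, by omega, hk2⟩
      · have : ω ∈ A := hω
        rw [indicator_of_mem this, indicator_of_mem this, if_neg hω]
        split_ifs with h3
        · obtain ⟨k, hk, hk2⟩ := h3
          have : k = n + 1 := by
            by_contra hne
            exact hω ⟨k, by omega, hk2⟩
          subst this
          linarith
        · linarith
    have := integral_mono (μ := ℙ.restrict D)
      ((hint (n + 1)).integrableOn.add i2.integrableOn)
      ((hint n).integrableOn.add i1.integrableOn) pw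
    simp only [Pi.add_apply] at this
    rw [integral_add (hint (n + 1)).integrableOn i2.integrableOn,
      integral_add (hint n).integrableOn i1.integrableOn] at this
    linarith

/-- Grid points of `[t, t + d]` close to a given point from the right. -/
lemma grid_near {t d u : ℝ≥0} (hd : 0 < d) (htu : t ≤ u) (hud : u ≤ t + d) {κ : ℝ} (hκ : 0 < κ) :
    ∀ᶠ n : ℕ in atTop, ∃ k ≤ n + 1, u ≤ t + d * (k / (n + 1)) ∧ t + d * (k / (n + 1)) ≤ t + d ∧
      ((t + d * (k / (n + 1)) : ℝ≥0) : ℝ) < u + κ := by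
  have ev : ∀ᶠ n : ℕ in atTop, (d : ℝ) / κ < n := by
    filter_upwards [eventually_gt_atTop ⌈(d : ℝ) / κ⌉₊] with n hn
    exact Nat.lt_of_ceil_lt hn
  filter_upwards [ev] with n hn
  have hdR : 0 < (d : ℝ) := hd
  have hn1 : (0 : ℝ) < n + 1 := by positivity
  have htuR : (t : ℝ) ≤ u := NNReal.coe_le_coe.mpr htu
  have hudR : (u : ℝ) ≤ t + d := by exact_mod_cast hud
  set x : ℝ := (u - t) * (n + 1) / d with hx
  have hx0 : 0 ≤ x := div_nonneg (mul_nonneg (by linarith) hn1.le) hdR.le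
  have hx1 : x ≤ n + 1 := by
    rw [hx, div_le_iff₀ hdR]; nlinarith
  have hkN : ⌈x⌉₊ ≤ n + 1 := Nat.ceil_le.mpr (by push_cast; exact hx1)
  have hk1 : x ≤ ⌈x⌉₊ := Nat.le_ceil x
  have hk2 : (⌈x⌉₊ : ℝ) < x + 1 := Nat.ceil_lt_add_one hx0
  have hkNR : (⌈x⌉₊ : ℝ) ≤ n + 1 := by exact_mod_cast hkN
  have ex : (d : ℝ) * (x / (n + 1)) = u - t := by rw [hx]; field_simp
  refine ⟨⌈x⌉₊, hkN, ?_, ?_, ?_⟩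
  · rw [← NNReal.coe_le_coe]; push_cast
    have : (d : ℝ) * (x / (n + 1)) ≤ d * (⌈x⌉₊ / (n + 1)) := by gcongr
    linarith
  · rw [← NNReal.coe_le_coe]; push_cast
    have : (⌈x⌉₊ : ℝ) / (n + 1) ≤ 1 := by rw [div_le_one hn1]; exact hkNR
    nlinarith
  · push_cast
    have h1 : (d : ℝ) * (⌈x⌉₊ / (n + 1)) < d * ((x + 1) / (n + 1)) := by gcongr
    have h2 : (d : ℝ) * ((x + 1) / (n + 1)) = (u - t) + d / (n + 1) := by
      rw [add_div, mul_add, ex]; ring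
    have h3 : (d : ℝ) / (n + 1) < κ := by
      rw [div_lt_iff₀ hn1]
      rw [div_lt_iff₀ hκ] at hn
      nlinarith
    linarith

lemma meas_hit {Ω : Type*} {m : MeasurableSpace Ω}
    (𝒢 : MeasureTheory.Filtration ℝ≥0 m)
    {Y : ℝ≥0 → Ω → ℝ} (hadp : MeasureTheory.Adapted 𝒢 Y) (hrc : RightCts Y)
    {a c₁ : ℝ} (hc₁ : 0 < c₁)
    (hU : StronglyAdapted 𝒢
      (fun (t : ℝ≥0) (ω : Ω) => Y (stopAt Y a t ω) ω + c₁ * ((stopAt Y a t ω : ℝ≥0) : ℝ))) :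
    Measurable (hitTime Y a) := by
  refine measurable_of_Ioi fun x => ?_
  induction x using ENNReal.recTopCoe with
  | top => simp
  | coe x => exact 𝒢.le x _ (meas_lt_hit 𝒢 hadp hrc hc₁ hU x)

open Classical in
lemma piece {Ω : Type*} {m : MeasurableSpace Ω}
    (𝒢 : MeasureTheory.Filtration ℝ≥0 m) (ℙ : Measure Ω) [IsProbabilityMeasure ℙ]
    {Y : ℝ≥0 → Ω → ℝ} (hadp : MeasureTheory.Adapted 𝒢 Y) (hrc : RightCts Y)
    (hY0 : ∀ t ω, 0 ≤ Y t ω)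
    {a c₁ c₂ r g : ℝ} (ha : 0 < a) (hc₁ : 0 < c₁) (hc₂ : 0 < c₂) (hr : 1 < r) (hg : 0 < g)
    (hgap : ∀ z η : ℝ, 0 ≤ z → 0 < η →
      (0 ≤ z ^ r - η ^ r - r * η ^ (r - 1) * (z - η)) ∧
      ((z ≤ η / 2 ∨ 2 * η ≤ z) → g * η ^ r ≤ z ^ r - η ^ r - r * η ^ (r - 1) * (z - η)))
    (hsub : Submartingale (UU Y a c₁) 𝒢 ℙ) (hsup : Supermartingale (XX Y a c₂ r) 𝒢 ℙ)
    {t d : ℝ≥0} (hd : 0 < d) {y : ℝ} (hya : 2 * a ≤ y) {c : ℝ}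
    (hc : c = 2 * c₂ * d * (4 * y) ^ (r - 1) + r * (2 * y) ^ (r - 1) * c₁ * d)
    (hcg : c < g * y ^ r) {D : Set Ω} (hD : MeasurableSet[𝒢 t] D)
    (hDs : ∀ ω ∈ D, (t : ℝ≥0∞) < hitTime Y a ω ∧ y ≤ Y t ω ∧ Y t ω < 2 * y) :
    g * y ^ r * ℙ.real (D ∩ {ω | hitTime Y a ω ≤ ((t + d : ℝ≥0) : ℝ≥0∞)}) ≤ c * ℙ.real D := by
  have hy : 0 < y := by linarith
  have hDm : MeasurableSet D := 𝒢.le t _ hD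
  have hc0 : 0 < c := by
    have h1 : 0 < (4 * y) ^ (r - 1) := Real.rpow_pos_of_pos (by linarith) _
    have h2 : 0 < (2 * y) ^ (r - 1) := Real.rpow_pos_of_pos (by linarith) _
    have hdR : 0 < (d : ℝ) := hd
    rw [hc]; positivity
  set G : ℝ := g * y ^ r with hG
  set w : Ω → ℝ := D.indicator (fun ω => Y t ω ^ (r - 1)) with hw
  have hwm : Measurable[𝒢 t] w :=
    Measurable.indicator (Measurable.pow_const (hadp t) _) hD
  have hw0 : ∀ ω, 0 ≤ w ω := fun ω =>
    indicator_nonneg (fun ω _ => Real.rpow_nonneg (hY0 _ _) _) ω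
  have hwK : ∀ ω, w ω ≤ (2 * y) ^ (r - 1) := by
    intro ω
    by_cases hω : ω ∈ D
    · rw [hw, indicator_of_mem hω]
      exact Real.rpow_le_rpow (hY0 _ _) (hDs ω hω).2.2.le (by linarith)
    · rw [hw, indicator_of_notMem hω]
      exact Real.rpow_nonneg (by linarith) _
  have hiwU : ∀ v, Integrable (fun ω => w ω * UU Y a c₁ v ω) ℙ := by
    intro v
    refine (hsub.integrable v).bdd_mul (c := (2 * y) ^ (r - 1))
      ((hwm.mono (𝒢.le t) le_rfl).aestronglyMeasurable) (Eventually.of_forall fun ω => ?_)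
    rw [Real.norm_eq_abs, abs_of_nonneg (hw0 ω)]; exact hwK ω
  set H : ℝ≥0 → Ω → ℝ := fun v ω => (XX Y a c₂ r v ω - XX Y a c₂ r t ω)
      - r * (w ω * UU Y a c₁ v ω - w ω * UU Y a c₁ t ω) with hH
  have hHi : ∀ v, Integrable (H v) ℙ := fun v =>
    ((hsup.integrable v).sub (hsup.integrable t)).sub (((hiwU v).sub (hiwU t)).const_mul r)
  have hHm : ∀ v, t ≤ v → Measurable[𝒢 v] (H v) := by
    intro v hv
    have m1 : Measurable[𝒢 v] (XX Y a c₂ r v) := (hsup.stronglyMeasurable v).measurable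
    have m2 : Measurable[𝒢 v] (XX Y a c₂ r t) :=
      (hsup.stronglyMeasurable t).measurable.mono (𝒢.mono hv) le_rfl
    have m3 : Measurable[𝒢 v] (UU Y a c₁ v) := (hsub.stronglyMeasurable v).measurable
    have m4 : Measurable[𝒢 v] (UU Y a c₁ t) :=
      (hsub.stronglyMeasurable t).measurable.mono (𝒢.mono hv) le_rfl
    have m5 : Measurable[𝒢 v] w := hwm.mono (𝒢.mono hv) le_rfl
    exact (m1.sub m2).sub (((m5.mul m3).sub (m5.mul m4)).const_mul r)
  have hHstep : ∀ u v, t ≤ u → u ≤ v → ∀ E, MeasurableSet[𝒢 u] E →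
      ∫ ω in E, H v ω ∂ℙ ≤ ∫ ω in E, H u ω ∂ℙ := by
    intro u v htu huv E hE
    have s1 := hsup.setIntegral_le huv hE
    have s2 := weighted_sub hsub huv (hwm.mono (𝒢.mono htu) le_rfl).stronglyMeasurable hw0 hwK hE
    have key : ∀ v, ∫ ω in E, H v ω ∂ℙ = (∫ ω in E, XX Y a c₂ r v ω ∂ℙ
        - ∫ ω in E, XX Y a c₂ r t ω ∂ℙ)
        - r * (∫ ω in E, w ω * UU Y a c₁ v ω ∂ℙ - ∫ ω in E, w ω * UU Y a c₁ t ω ∂ℙ) := by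
      intro v
      have j1 := (hsup.integrable v).integrableOn (s := E)
      have j2 := (hsup.integrable t).integrableOn (s := E)
      have j3 := (hiwU v).integrableOn (s := E)
      have j4 := (hiwU t).integrableOn (s := E)
      rw [← integral_sub j1 j2, ← integral_sub j3 j4, ← integral_const_mul,
        ← integral_sub (f := fun ω => XX Y a c₂ r v ω - XX Y a c₂ r t ω)
          (g := fun ω => r * (w ω * UU Y a c₁ v ω - w ω * UU Y a c₁ t ω))
          (j1.sub j2) ((j3.sub j4).const_mul r)]
    rw [key v, key u]
    have : r * (∫ ω in E, w ω * UU Y a c₁ u ω ∂ℙ) ≤ r * (∫ ω in E, w ω * UU Y a c₁ v ω ∂ℙ) :=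
      mul_le_mul_of_nonneg_left s2 (by linarith)
    linarith
  have hH0 : ∀ ω, H t ω = 0 := fun ω => by simp [hH]
  set V : ℕ → ℕ → ℝ≥0 := fun n k => t + d * ((k : ℝ≥0) / ((n : ℝ≥0) + 1)) with hV
  have hVmono : ∀ n, Monotone (V n) := by
    intro n i j hij
    simp only [hV]
    gcongr
  have hV0 : ∀ n, V n 0 = t := fun n => by simp [hV]
  have hVN : ∀ n, V n (n + 1) = t + d := fun n => by
    simp only [hV]; push_cast
    rw [div_self (by positivity), mul_one]
  have hVt : ∀ n k, t ≤ V n k := fun n k => le_self_add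
  set l := G - c with hl
  have hl0 : 0 < l := by rw [hl]; linarith
  set Q : ℕ → Ω → ℝ := fun n ω => if ∃ k ≤ n + 1, l ≤ H (V n k) ω then l else H (t + d) ω with hQ
  have hQd : ∀ n, IntegrableOn (Q n) D ℙ ∧ ∫ ω in D, Q n ω ∂ℙ ≤ 0 := by
    intro n
    have := disc_max (ℙ := ℙ) (fun k => 𝒢 (V n k)) (fun i j hij => 𝒢.mono (hVmono n hij))
      (fun k => 𝒢.le _) (fun k => H (V n k)) (fun ω => by simp only [hV0, hH0])
      (fun k => hHi _) (fun k => hHm _ (hVt n k)) (D := D) (by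
        show MeasurableSet[𝒢 (V n 0)] D
        rw [hV0]; exact hD) (n + 1)
      (fun k _ E hE _ => hHstep _ _ (hVt n k) (hVmono n (Nat.le_succ k)) E hE) hl0
    simp only [hVN] at this
    exact this
  have hTm : Measurable (hitTime Y a) := meas_hit 𝒢 hadp hrc hc₁ hsub.1
  set A : Set Ω := {ω | hitTime Y a ω ≤ ((t + d : ℝ≥0) : ℝ≥0∞)} with hA
  have hAm : MeasurableSet A := measurableSet_le hTm measurable_const
  set ψ : Ω → ℝ := fun ω => A.indicator (fun _ => G) ω - c with hψ
  have hG0 : 0 < G := by linarith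
  have hψi : Integrable ψ ℙ := ((integrable_const G).indicator hAm).sub (integrable_const c)
  have hψb : ∀ ω, -c ≤ ψ ω ∧ ψ ω ≤ l := by
    intro ω
    by_cases hω : ω ∈ A
    · simp only [hψ, indicator_of_mem hω]; constructor <;> linarith
    · simp only [hψ, indicator_of_notMem hω]; constructor <;> linarith
  have hmi : ∀ n, IntegrableOn (fun ω => min (Q n ω) (ψ ω)) D ℙ := fun n =>
    (hQd n).1.inf hψi.integrableOn
  have hlim : Tendsto (fun n => ∫ ω in D, min (Q n ω) (ψ ω) ∂ℙ) atTop
      (nhds (∫ ω in D, ψ ω ∂ℙ)) := by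
    refine tendsto_integral_of_dominated_convergence (fun ω => |H (t + d) ω| + (l + c))
      (fun n => (hmi n).aestronglyMeasurable)
      (((hHi _).abs.add (integrable_const _)).integrableOn) ?_ ?_
    · intro n
      refine Eventually.of_forall fun ω => ?_
      have h1 := hψb ω
      have h2 : -|H (t + d) ω| ≤ Q n ω := by
        simp only [hQ]
        split_ifs
        · have := abs_nonneg (H (t + d) ω); linarith
        · exact neg_abs_le _
      have h3 := abs_nonneg (H (t + d) ω)
      rw [Real.norm_eq_abs, abs_le]
      constructor
      · refine le_min ?_ ?_ <;> linarith
      · exact (min_le_right _ _).trans (by linarith)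
    · refine ae_restrict_of_forall_mem hDm fun ω hω => ?_
      refine tendsto_const_nhds.congr' ?_
      obtain ⟨q1, q2, q3⟩ := hDs ω hω
      have pb := path_bound hrc hY0 ha hc₁ hc₂ hr hg hgap hd q1 hya q2 q3 hc
      have hHe : ∀ v, (XX Y a c₂ r v ω - XX Y a c₂ r t ω)
          - r * (Y t ω) ^ (r - 1) * (UU Y a c₁ v ω - UU Y a c₁ t ω) = H v ω := by
        intro v
        simp only [hH, hw, indicator_of_mem hω]; ring
      simp only [hHe] at pb
      rcases pb with ⟨p1, p2⟩ | ⟨u, hu1, hu2, κ, hκ, hu3⟩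
      · refine Eventually.of_forall fun n => ?_
        symm
        refine min_eq_right ?_
        simp only [hQ]
        split_ifs
        · exact (hψb ω).2
        · by_cases hωA : ω ∈ A
          · simp only [hψ, indicator_of_mem hωA]; exact p2 hωA
          · simp only [hψ, indicator_of_notMem hωA]; linarith
      · filter_upwards [grid_near hd hu1 hu2 hκ] with n hn
        obtain ⟨k, hk, hk1, hk2, hk3⟩ := hn
        symm
        refine min_eq_right ?_
        simp only [hQ]
        rw [if_pos ⟨k, hk, hu3 _ hk1 hk2 hk3⟩]
        exact (hψb ω).2
  have hfin : ∫ ω in D, ψ ω ∂ℙ ≤ 0 := by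
    refine le_of_tendsto' hlim fun n => ?_
    exact (setIntegral_mono (hmi n) (hQd n).1 (fun ω => min_le_left _ _)).trans (hQd n).2
  have e : ∫ ω in D, ψ ω ∂ℙ = G * ℙ.real (D ∩ A) - c * ℙ.real D := by
    simp only [hψ]
    rw [integral_sub ((integrable_const G).indicator hAm).integrableOn (integrable_const c),
      setIntegral_indicator hAm]
    simp [mul_comm]
  linarith

/-- Proposition: for a nonnegative adapted process `Y` (with values in an
unbounded subset of `[0,∞)`) satisfying, before the hitting time `T_a` of
`[0,a]`, a lower drift bound `E(dY_t|𝒢_{t-}) ≥ -c₁ dt` and an upper bound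
`E(dY_t^r|𝒢_{t-}) ≤ c₂ Y_{t-}^{r-1} dt` for some `r > 1`, for every
`α ∈ (0,1)` there are `ε, δ > 0` such that for all `t > 0`,
`ℙ(T_a > t + ε Y_{t∧T_a} | 𝒢_t) ≥ 1 - α` on `{T_a > t, Y_t > a(1+δ)}`. -/
theorem statement15 {Ω : Type*} {m : MeasurableSpace Ω}
    (𝒢 : MeasureTheory.Filtration ℝ≥0 m) (ℙ : Measure Ω) [IsProbabilityMeasure ℙ]
    (Y : ℝ≥0 → Ω → ℝ) (hadp : MeasureTheory.Adapted 𝒢 Y) (hrc : RightCts Y)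
    (S : Set ℝ) (hS0 : S ⊆ Set.Ici 0) (hSunbdd : ¬ BddAbove S) (hYS : ∀ t ω, Y t ω ∈ S)
    (a : ℝ) (ha : 0 < a)
    (c₁ c₂ r : ℝ) (hc₁ : 0 < c₁) (hc₂ : 0 < c₂) (hr : 1 < r)
    (hsub : MeasureTheory.Submartingale
      (fun (t : ℝ≥0) (ω : Ω) => Y (stopAt Y a t ω) ω + c₁ * ((stopAt Y a t ω : ℝ≥0) : ℝ)) 𝒢 ℙ)
    (hsup : MeasureTheory.Supermartingale
      (fun (t : ℝ≥0) (ω : Ω) => Y (stopAt Y a t ω) ω ^ r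
        - c₂ * ∫ s in Set.Ioc (0:ℝ) ((stopAt Y a t ω : ℝ≥0) : ℝ), Y s.toNNReal ω ^ (r - 1)) 𝒢 ℙ) :
    ∀ α : ℝ, 0 < α → α < 1 → ∃ ε : ℝ, 0 < ε ∧ ∃ δ : ℝ, 0 < δ ∧ ∀ t : ℝ≥0, 0 < t →
      ∀ᵐ ω ∂ℙ, ((t : ℝ≥0∞) < hitTime Y a ω ∧ a * (1 + δ) < Y t ω) →
        1 - α ≤ (ℙ[Set.indicator
            {ω' | (t : ℝ≥0∞) + ENNReal.ofReal (ε * Y (stopAt Y a t ω') ω') < hitTime Y a ω'}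
            (fun _ => (1:ℝ)) | 𝒢 t]) ω := by
  intro α hα0 hα1
  obtain ⟨g, hg, hgap⟩ := convex_gap r hr
  have hY0 : ∀ t ω, 0 ≤ Y t ω := fun t ω => hS0 (hYS t ω)
  have hsub' : Submartingale (UU Y a c₁) 𝒢 ℙ := hsub
  have hsup' : Supermartingale (XX Y a c₂ r) 𝒢 ℙ := hsup
  set C : ℝ := 4 ^ r * c₂ + r * 2 ^ r * c₁ with hC
  have hC0 : 0 < C := by positivity
  set ε : ℝ := α * g / C with hε
  have hε0 : 0 < ε := by positivity
  have hTm : Measurable (hitTime Y a) := meas_hit 𝒢 hadp hrc hc₁ hsub.1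
  refine ⟨ε, hε0, 1, one_pos, fun t _ => ?_⟩
  set A : Set Ω := {ω' | (t : ℝ≥0∞) + ENNReal.ofReal (ε * Y (stopAt Y a t ω') ω')
    < hitTime Y a ω'} with hA
  have hAm : MeasurableSet A := by
    have h1 : Measurable (fun ω => stopAt Y a t ω) :=
      (measurable_const.min hTm).ennreal_toNNReal
    have h2 : Measurable (fun ω => Y (stopAt Y a t ω) ω) := by
      have h3 : Measurable (UU Y a c₁ t) :=
        ((hsub'.stronglyMeasurable t).mono (𝒢.le t)).measurable
      have : (fun ω => Y (stopAt Y a t ω) ω)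
          = fun ω => UU Y a c₁ t ω - c₁ * ((stopAt Y a t ω : ℝ≥0) : ℝ) := by
        ext ω; simp [UU]
      rw [this]
      exact h3.sub (h1.coe_nnreal_real.const_mul c₁)
    exact measurableSet_lt (measurable_const.add (h2.const_mul ε).ennreal_ofReal) hTm
  set f : Ω → ℝ := A.indicator (fun _ => (1 : ℝ)) with hf
  have hfi : Integrable f ℙ := (integrable_const 1).indicator hAm
  have main : ∀ n : ℕ, ∀ᵐ ω ∂ℙ, ((t : ℝ≥0∞) < hitTime Y a ω ∧ 2 * a * 2 ^ n ≤ Y t ω ∧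
      Y t ω < 2 * (2 * a * 2 ^ n)) → 1 - α ≤ (ℙ[f | 𝒢 t]) ω := by
    intro n
    set y : ℝ := 2 * a * 2 ^ n with hy
    have hya : 2 * a ≤ y := by
      have : (1 : ℝ) ≤ 2 ^ n := one_le_pow₀ (by norm_num)
      rw [hy]; nlinarith
    have hy0 : 0 < y := by linarith
    have hcm : Measurable[𝒢 t] (ℙ[f | 𝒢 t]) := stronglyMeasurable_condExp.measurable
    set D : Set Ω := ({ω | (t : ℝ≥0∞) < hitTime Y a ω} ∩ ({ω | y ≤ Y t ω} ∩ {ω | Y t ω < 2 * y}))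
      ∩ {ω | (ℙ[f | 𝒢 t]) ω < 1 - α} with hD
    have hDm : MeasurableSet[𝒢 t] D := by
      have hYt : Measurable[𝒢 t] (Y t) := hadp t
      refine MeasurableSet.inter (MeasurableSet.inter (meas_lt_hit 𝒢 hadp hrc hc₁ hsub.1 t)
        (MeasurableSet.inter ?_ ?_)) ?_
      · exact measurableSet_le measurable_const hYt
      · exact measurableSet_lt hYt measurable_const
      · exact measurableSet_lt hcm measurable_const
    have hDm' : MeasurableSet D := 𝒢.le t _ hDm
    set d : ℝ≥0 := (2 * ε * y).toNNReal with hd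
    have hdpos : 0 < 2 * ε * y := by positivity
    have hd0 : 0 < d := Real.toNNReal_pos.mpr hdpos
    have hdR : (d : ℝ) = 2 * ε * y := Real.coe_toNNReal _ hdpos.le
    have hyr : 0 < y ^ r := Real.rpow_pos_of_pos hy0 r
    have hceq : α * g * y ^ r
        = 2 * c₂ * d * (4 * y) ^ (r - 1) + r * (2 * y) ^ (r - 1) * c₁ * d := by
      have e1 : (4 * y) ^ (r - 1) = 4 ^ r * y ^ r / (4 * y) := by
        rw [Real.rpow_sub_one (by positivity), Real.mul_rpow (by norm_num) hy0.le]
      have e2 : (2 * y) ^ (r - 1) = 2 ^ r * y ^ r / (2 * y) := by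
        rw [Real.rpow_sub_one (by positivity), Real.mul_rpow (by norm_num) hy0.le]
      have e3 : α * g = ε * C := by rw [hε]; field_simp
      rw [hdR, e1, e2, e3, hC]
      field_simp
      ring
    have hp := piece 𝒢 ℙ hadp hrc hY0 ha hc₁ hc₂ hr hg hgap hsub' hsup' hd0 hya hceq
      (by
        have : α * (g * y ^ r) < 1 * (g * y ^ r) := mul_lt_mul_of_pos_right hα1 (by positivity)
        linarith) hDm (fun ω hω => ⟨hω.1.1, hω.1.2.1, hω.1.2.2⟩)
    have hp2 : ℙ.real (D ∩ {ω | hitTime Y a ω ≤ ((t + d : ℝ≥0) : ℝ≥0∞)}) ≤ α * ℙ.real D := by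
      have : 0 < g * y ^ r := by positivity
      refine le_of_mul_le_mul_left ?_ this
      linarith
    have hsubset : D \ A ⊆ D ∩ {ω | hitTime Y a ω ≤ ((t + d : ℝ≥0) : ℝ≥0∞)} := by
      rintro ω ⟨hω, hωA⟩
      refine ⟨hω, ?_⟩
      have h1 : hitTime Y a ω ≤ (t : ℝ≥0∞) + ENNReal.ofReal (ε * Y (stopAt Y a t ω) ω) :=
        not_lt.mp (fun hlt => hωA hlt)
      refine h1.trans ?_
      rw [stopAt_of_le (le_of_lt hω.1.1)]
      push_cast
      gcongr
      rw [hd, ← ENNReal.ofReal]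
      refine ENNReal.ofReal_le_ofReal ?_
      have : Y t ω < 2 * y := hω.1.2.2
      nlinarith
    have hp3 : ℙ.real (D \ A) ≤ α * ℙ.real D := (measureReal_mono hsubset).trans hp2
    have hsum : ℙ.real (D ∩ A) + ℙ.real (D \ A) = ℙ.real D :=
      measureReal_inter_add_sdiff hAm
    have hce : ∫ ω in D, (ℙ[f | 𝒢 t]) ω ∂ℙ = ℙ.real (D ∩ A) := by
      rw [setIntegral_condExp (𝒢.le t) hfi hDm, hf, setIntegral_indicator hAm]
      simp
    have hI : IntegrableOn (fun ω => 1 - α - (ℙ[f | 𝒢 t]) ω) D ℙ :=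
      ((integrable_const _).sub integrable_condExp).integrableOn
    have hle : ∫ ω in D, (1 - α - (ℙ[f | 𝒢 t]) ω) ∂ℙ ≤ 0 := by
      rw [integral_sub (integrable_const _) integrable_condExp.integrableOn, hce]
      simp only [integral_const, measureReal_restrict_apply_univ, smul_eq_mul]
      nlinarith
    have hnn : 0 ≤ᵐ[ℙ.restrict D] (fun ω => 1 - α - (ℙ[f | 𝒢 t]) ω) := by
      refine ae_restrict_of_forall_mem hDm' fun ω hω => ?_
      have : (ℙ[f | 𝒢 t]) ω < 1 - α := hω.2
      simp only [Pi.zero_apply]; linarith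
    have hD0 : ℙ D = 0 := by
      by_contra hne
      have hpos := (setIntegral_pos_iff_support_of_nonneg_ae hnn hI).mpr (by
        refine (pos_iff_ne_zero.mpr hne).trans_le (measure_mono fun ω hω => ⟨?_, hω⟩)
        have : (ℙ[f | 𝒢 t]) ω < 1 - α := hω.2
        rw [Function.mem_support]; linarith)
      linarith
    have : ∀ᵐ ω ∂ℙ, ω ∉ D := measure_eq_zero_iff_ae_notMem.mp hD0
    filter_upwards [this] with ω hω h
    by_contra hcon
    exact hω ⟨⟨h.1, h.2.1, h.2.2⟩, not_le.mp hcon⟩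
  filter_upwards [ae_all_iff.mpr main] with ω hω h
  obtain ⟨h1, h2⟩ := h
  have hx : 1 ≤ Y t ω / (2 * a) := by
    rw [le_div_iff₀ (by positivity)]; linarith
  obtain ⟨n, hn1, hn2⟩ := exists_nat_pow_near hx (one_lt_two : (1 : ℝ) < 2)
  refine hω n ⟨h1, ?_, ?_⟩
  · rw [le_div_iff₀ (by positivity)] at hn1; linarith
  · rw [div_lt_iff₀ (by positivity), pow_succ] at hn2; linarith
end

section
/- Let (Ω, 𝒢, (𝒢_t)_{t≥0}, ℙ) be a filtered probability space and (X_t)_{t≥0} a [0,∞)-valued (𝒢_t)-adapted process; for a > 0 let T_a := inf{t ≥ 0 : X_t ≤ a}. Suppose there exist positive constants a, c₁, c₂, p and r > 1 such that X_0 = x > a almost surely, (X_{t∧T_a} + c₁·(t∧T_a)) is a submartingale, (X_{t∧T_a}^r − c₂·∫_0^{t∧T_a} X_s^{r−1} ds) is a supermartingale, and (X_{t∧T_a}^p) is a submartingale. Then E(T_a^q) = ∞ for all q > p. -/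
open MeasureTheory Set Filter
open scoped ENNReal NNReal

lemma aux_FS {Ω : Type*} {m : MeasurableSpace Ω} (μ : Measure Ω) [IsFiniteMeasure μ]
    (D : ℕ → Ω → ℝ) (E G : Ω → ℝ) (B : ℝ)
    (hD : ∀ N, Integrable (D N) μ) (hD0 : ∀ N, ∫ ω, D N ω ∂μ ≤ 0) (hE : Integrable E μ)
    (hUI : ∀ N (K : ℝ), ∫ ω, max (-D N ω - K) 0 ∂μ ≤ ∫ ω, max (-E ω - K) 0 ∂μ)
    (hG : Measurable G) (hGB : ∀ ω, |G ω| ≤ B)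
    (hlim : ∀ᵐ ω ∂μ, ∀ η > 0, ∀ᶠ N in atTop, G ω - η ≤ D N ω) :
    ∫ ω, G ω ∂μ ≤ 0 := by
  have key : ∀ K : ℕ, B ≤ K → ∫ ω, G ω ∂μ ≤ ∫ ω, max (-E ω - K) 0 ∂μ := by
    intro K hK
    have hK0 : (0:ℝ) ≤ K := Nat.cast_nonneg K
    have hm : ∀ N, AEStronglyMeasurable (fun ω => max (min (D N ω) (G ω)) (-(K:ℝ))) μ := fun N =>
      (((hD N).aestronglyMeasurable.aemeasurable.min hG.aemeasurable).max
        aemeasurable_const).aestronglyMeasurable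
    have hb : ∀ N, ∀ᵐ ω ∂μ, ‖max (min (D N ω) (G ω)) (-(K:ℝ))‖ ≤ (K:ℝ) := by
      intro N
      refine Eventually.of_forall fun ω => ?_
      have := abs_le.1 (hGB ω)
      rw [Real.norm_eq_abs, abs_le]
      refine ⟨le_max_right _ _, max_le ((min_le_right _ _).trans (by linarith)) (by linarith)⟩
    have h1 : Tendsto (fun N => ∫ ω, max (min (D N ω) (G ω)) (-(K:ℝ)) ∂μ) atTop
        (nhds (∫ ω, G ω ∂μ)) := by
      refine tendsto_integral_of_dominated_convergence (fun _ => (K:ℝ)) hm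
        (integrable_const _) hb ?_
      filter_upwards [hlim] with ω hω
      rw [Metric.tendsto_atTop]
      intro η hη
      obtain ⟨N0, hN0⟩ := eventually_atTop.1 (hω (η/2) (by positivity))
      refine ⟨N0, fun n hn => ?_⟩
      have h2 := hN0 n hn
      have := abs_le.1 (hGB ω)
      rw [Real.dist_eq, abs_lt]
      constructor
      · have : G ω - η/2 ≤ min (D n ω) (G ω) := le_min h2 (by linarith)
        have := le_max_left (min (D n ω) (G ω)) (-(K:ℝ))
        linarith
      · have : max (min (D n ω) (G ω)) (-(K:ℝ)) ≤ G ω := max_le (min_le_right _ _) (by linarith)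
        linarith
    refine le_of_tendsto h1 (Eventually.of_forall fun N => ?_)
    have hi : Integrable (fun ω => max (-D N ω - K) 0) μ :=
      ((hD N).neg.sub (integrable_const (K:ℝ))).pos_part
    calc ∫ ω, max (min (D N ω) (G ω)) (-(K:ℝ)) ∂μ
        ≤ ∫ ω, (D N ω + max (-D N ω - K) 0) ∂μ := by
          refine integral_mono_ae (Integrable.of_bound (hm N) _ (hb N)) ((hD N).add hi) ?_
          refine Eventually.of_forall fun ω => ?_
          refine max_le ((min_le_left _ _).trans ?_) ?_
          · have := le_max_right (-D N ω - K) 0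
            linarith
          · have := le_max_left (-D N ω - K) 0
            linarith
      _ = ∫ ω, D N ω ∂μ + ∫ ω, max (-D N ω - K) 0 ∂μ := integral_add (hD N) hi
      _ ≤ _ := by linarith [hD0 N, hUI N K]
  have h0 : Tendsto (fun K : ℕ => ∫ ω, max (-E ω - K) 0 ∂μ) atTop (nhds (∫ _, (0:ℝ) ∂μ)) := by
    refine tendsto_integral_of_dominated_convergence (fun ω => |E ω|) ?_ hE.abs ?_ ?_
    · intro K
      exact ((hE.neg.sub (integrable_const (K:ℝ))).pos_part).aestronglyMeasurable
    · intro K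
      refine Eventually.of_forall fun ω => ?_
      have hK0 : (0:ℝ) ≤ K := Nat.cast_nonneg K
      rw [Real.norm_eq_abs, abs_of_nonneg (le_max_right _ _)]
      exact max_le (by linarith [neg_le_abs (E ω)]) (abs_nonneg _)
    · refine Eventually.of_forall fun ω => ?_
      refine tendsto_const_nhds.congr' ?_
      filter_upwards [eventually_ge_atTop ⌈-E ω⌉₊] with K hK
      have := Nat.ceil_le.1 hK
      rw [max_eq_right]; linarith
  rw [integral_zero] at h0
  refine ge_of_tendsto h0 ?_
  filter_upwards [eventually_ge_atTop ⌈B⌉₊] with K hK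
  exact key K (Nat.ceil_le.1 hK)

lemma aux_int (f : ℝ≥0 → ℝ) (hf : ∀ s, 0 ≤ f s) (e B : ℝ) (he : 0 ≤ e) (u v : ℝ≥0) (huv : u ≤ v)
    (hB : ∀ w, u < w → w < v → f w ≤ B) (hB0 : 0 ≤ B) :
    (∫ s in Set.Ioc (0:ℝ) (v:ℝ), f s.toNNReal ^ e) - (∫ s in Set.Ioc (0:ℝ) (u:ℝ), f s.toNNReal ^ e)
      ≤ B ^ e * ((v:ℝ) - u) := by
  have huv' : (u:ℝ) ≤ v := by exact_mod_cast huv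
  by_cases hi : IntegrableOn (fun s : ℝ => f s.toNNReal ^ e) (Set.Ioc (0:ℝ) (v:ℝ))
  · have hun : Set.Ioc (0:ℝ) (v:ℝ) = Set.Ioc (0:ℝ) u ∪ Set.Ioc (u:ℝ) v :=
      (Set.Ioc_union_Ioc_eq_Ioc u.2 huv').symm
    rw [hun] at hi ⊢
    rw [setIntegral_union (Set.Ioc_disjoint_Ioc_of_le le_rfl) measurableSet_Ioc
      hi.left_of_union hi.right_of_union, add_sub_cancel_left, integral_Ioc_eq_integral_Ioo]
    have := norm_setIntegral_le_of_norm_le_const (μ := volume) (s := Set.Ioo (u:ℝ) v)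
      (f := fun s : ℝ => f s.toNNReal ^ e) (C := B ^ e) (by simp) (by
        intro s hs
        have h0 : 0 ≤ s := u.2.trans hs.1.le
        rw [Real.norm_eq_abs, abs_of_nonneg (Real.rpow_nonneg (hf _) _)]
        refine Real.rpow_le_rpow (hf _) (hB _ ?_ ?_) he
        · rw [← NNReal.coe_lt_coe, Real.coe_toNNReal _ h0]; exact hs.1
        · rw [← NNReal.coe_lt_coe, Real.coe_toNNReal _ h0]; exact hs.2)
    rw [Measure.real, Real.volume_Ioo, ENNReal.toReal_ofReal (by linarith)] at this
    exact (le_abs_self _).trans this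
  · rw [integral_undef hi]
    have h1 : 0 ≤ ∫ s in Set.Ioc (0:ℝ) (u:ℝ), f s.toNNReal ^ e :=
      integral_nonneg fun s => Real.rpow_nonneg (hf _) _
    have h2 : 0 ≤ B ^ e * ((v:ℝ) - u) :=
      mul_nonneg (Real.rpow_nonneg hB0 _) (by linarith)
    linarith

/-- grid points -/
noncomputable def aux_grid (t h : ℝ≥0) (N i : ℕ) : ℝ≥0 := t + h * ((i : ℝ≥0) / ((N : ℝ≥0) + 1))

lemma aux_grid_mono (t h : ℝ≥0) (N : ℕ) : Monotone (aux_grid t h N) := by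
  intro i j hij
  unfold aux_grid
  gcongr

lemma aux_grid_zero (t h : ℝ≥0) (N : ℕ) : aux_grid t h N 0 = t := by simp [aux_grid]

lemma aux_grid_last (t h : ℝ≥0) (N : ℕ) : aux_grid t h N (N+1) = t + h := by
  unfold aux_grid
  rw [Nat.cast_add, Nat.cast_one, div_self (by positivity), mul_one]

lemma aux_OS {Ω : Type*} {m : MeasurableSpace Ω}
    (𝒢 : Filtration ℝ≥0 m) (ℙ : Measure Ω) [IsProbabilityMeasure ℙ]
    (V Y : ℝ≥0 → Ω → ℝ) (hV : Supermartingale V 𝒢 ℙ) (hY : Adapted 𝒢 Y)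
    (t h : ℝ≥0) (A : Set Ω) (hA : MeasurableSet[𝒢 t] A) (L : ℝ) (N : ℕ) :
    let D : Ω → ℝ := fun ω =>
      V (aux_grid t h N (hittingBtwn (fun i ω => Y (aux_grid t h N i) ω) (Ioi L) 0 (N+1) ω)) ω - V t ω
    Integrable D (ℙ.restrict A) ∧ ∫ ω in A, D ω ∂ℙ ≤ 0 ∧
      ∀ K : ℝ, ∫ ω in A, max (-D ω - K) 0 ∂ℙ
        ≤ ∫ ω in A, max (-(V (t+h) ω - V t ω) - K) 0 ∂ℙ := by
  intro D
  let ℱ : Filtration ℕ m :=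
    ⟨fun i => 𝒢 (aux_grid t h N i), fun i j hij => 𝒢.mono (aux_grid_mono t h N hij),
      fun i => 𝒢.le _⟩
  have htg : ∀ i, t ≤ aux_grid t h N i := fun i => by simp [aux_grid]
  have hAm : MeasurableSet A := 𝒢.le _ _ hA
  let W : ℕ → Ω → ℝ := fun i ω => -(V (aux_grid t h N i) ω - V t ω)
  have hW : Submartingale W ℱ (ℙ.restrict A) := by
    refine submartingale_of_setIntegral_le ?_ ?_ ?_
    · intro i
      exact ((hV.1 _).sub ((hV.1 t).mono (𝒢.mono (htg i)))).neg
    · intro i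
      exact (((hV.integrable _).sub (hV.integrable t)).neg).restrict
    · intro i j hij s hs
      have hsm : MeasurableSet s := ℱ.le i _ hs
      rw [Measure.restrict_restrict hsm]
      have hsA : MeasurableSet[𝒢 (aux_grid t h N i)] (s ∩ A) :=
        MeasurableSet.inter hs (𝒢.mono (htg i) _ hA)
      have := hV.setIntegral_le (aux_grid_mono t h N hij) hsA
      simp only [W]
      rw [integral_neg, integral_neg, integral_sub (hV.integrable _).restrict (hV.integrable _).restrict,
        integral_sub (hV.integrable _).restrict (hV.integrable _).restrict]
      linarith
  let σ : Ω → WithTop ℕ := fun ω =>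
    ((hittingBtwn (fun i ω => Y (aux_grid t h N i) ω) (Ioi L) 0 (N+1) ω : ℕ) : WithTop ℕ)
  have hσ : IsStoppingTime ℱ σ :=
    Adapted.isStoppingTime_hittingBtwn (f := ℱ) (fun i => hY _) measurableSet_Ioi
  have hσle : ∀ ω, σ ω ≤ ((N+1 : ℕ) : WithTop ℕ) := fun ω => by
    exact WithTop.coe_le_coe.2 (hittingBtwn_le ω)
  have hWσ : stoppedValue W σ = fun ω => - D ω := rfl
  have hint : Integrable (stoppedValue W σ) (ℙ.restrict A) :=
    hW.integrable_stoppedValue hσ hσle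
  refine ⟨?_, ?_, ?_⟩
  · have := hint.neg
    rw [hWσ] at this
    simpa using this
  · have := hW.expected_stoppedValue_mono (isStoppingTime_const ℱ 0) hσ
      (fun ω => WithTop.coe_le_coe.2 (Nat.zero_le _)) hσle
    rw [hWσ] at this
    rw [integral_neg] at this
    have h0 : (stoppedValue W fun _ => ((0:ℕ) : WithTop ℕ)) = fun _ => 0 := by
      ext ω; change W 0 ω = 0; simp [W, aux_grid_zero]
    have h0' : (∫ ω, (stoppedValue W fun _ => ((0:ℕ) : WithTop ℕ)) ω ∂(ℙ.restrict A)) = 0 := by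
      rw [h0]; simp
    change (∫ ω, (stoppedValue W fun _ => ((0:ℕ) : WithTop ℕ)) ω ∂(ℙ.restrict A)) ≤ _ at this
    linarith
  · intro K
    have hWK : Submartingale (fun i ω => max (W i ω - K) 0) ℱ (ℙ.restrict A) :=
      (hW.sub_martingale (martingale_const ℱ (ℙ.restrict A) K)).pos
    have := hWK.expected_stoppedValue_mono hσ (isStoppingTime_const ℱ (N+1)) hσle (fun ω => le_rfl)
    rw [stoppedValue_const] at this
    simp only [W, aux_grid_last] at this
    exact this

lemma aux_hit {Ω : Type*} (Y : ℝ≥0 → Ω → ℝ) (ω : Ω)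
    (hY : ∀ v, Tendsto (fun s => Y s ω) (nhdsWithin v (Set.Ici v)) (nhds (Y v ω)))
    (t h : ℝ≥0) (hh : 0 < h) (L : ℝ) (S : Set ℝ≥0)
    (hS : S = {v | t ≤ v ∧ v ≤ t + h ∧ L < Y v ω}) (hne : S.Nonempty) (η : ℝ≥0) (hη : 0 < η) :
    ∀ᶠ N in atTop, ∃ k, hittingBtwn (fun i ω => Y (aux_grid t h N i) ω) (Ioi L) 0 (N+1) ω = k ∧
      L < Y (aux_grid t h N k) ω ∧ sInf S ≤ aux_grid t h N k ∧ aux_grid t h N k < sInf S + η := by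
  have hbd : BddBelow S := OrderBot.bddBelow S
  have htg : ∀ N i, t ≤ aux_grid t h N i := fun N i => by simp [aux_grid]
  -- reduction: it suffices to find one grid point in the set
  have red : ∀ N i, i ≤ N + 1 → L < Y (aux_grid t h N i) ω → aux_grid t h N i < sInf S + η →
      ∃ k, hittingBtwn (fun i ω => Y (aux_grid t h N i) ω) (Ioi L) 0 (N+1) ω = k ∧
      L < Y (aux_grid t h N k) ω ∧ sInf S ≤ aux_grid t h N k ∧ aux_grid t h N k < sInf S + η := by
    intro N i hi hL hlt
    refine ⟨_, rfl, ?_⟩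
    have h1 := hittingBtwn_mem_set (u := fun i ω => Y (aux_grid t h N i) ω) (s := Ioi L) (n := 0)
      (m := N + 1) (ω := ω) ⟨i, ⟨Nat.zero_le _, hi⟩, hL⟩
    have h2 := hittingBtwn_le_of_mem (u := fun i ω => Y (aux_grid t h N i) ω) (s := Ioi L) (n := 0)
      (m := N + 1) (ω := ω) (Nat.zero_le i) hi hL
    refine ⟨h1, ?_, (aux_grid_mono t h N h2).trans_lt hlt⟩
    refine csInf_le hbd ?_
    rw [hS]
    refine ⟨htg _ _, ?_, h1⟩
    rw [← aux_grid_last t h N]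
    exact aux_grid_mono t h N (h2.trans hi)
  obtain ⟨v0, hv0⟩ := hne
  have hv0' := hv0
  rw [hS] at hv0'
  have hle : sInf S ≤ t + h := (csInf_le hbd hv0).trans hv0'.2.1
  rcases hle.eq_or_lt with heq | hlt
  · have hv : v0 = t + h := le_antisymm hv0'.2.1 (heq ▸ csInf_le hbd hv0)
    refine Eventually.of_forall fun N => red N (N+1) le_rfl ?_ ?_
    · rw [aux_grid_last, ← hv]; exact hv0'.2.2
    · rw [aux_grid_last, heq]; exact lt_add_of_pos_right _ hη
  · obtain ⟨v, hvS, hvlt⟩ := exists_lt_of_csInf_lt ⟨v0, hv0⟩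
      (show sInf S < min (sInf S + η) (t + h) from lt_min (lt_add_of_pos_right _ hη) hlt)
    rw [hS] at hvS
    have hev := (hY v).eventually (lt_mem_nhds hvS.2.2)
    obtain ⟨u, hu, hsub⟩ := mem_nhdsGE_iff_exists_Ico_subset.1 hev
    set u' := min u (min (sInf S + η) (t + h)) with hu'
    have hvu : v < u' := lt_min hu hvlt
    have hvu' : (v:ℝ) < u' := by exact_mod_cast hvu
    have hh' : (0:ℝ) < h := by exact_mod_cast hh
    have htv : (t:ℝ) ≤ v := by exact_mod_cast hvS.1
    obtain ⟨N0, hN0⟩ := exists_nat_gt ((h:ℝ) / (u' - v))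
    filter_upwards [eventually_ge_atTop N0] with N hN
    have hN1 : (h:ℝ) / (u' - v) < (N:ℝ) + 1 := by
      have : (N0:ℝ) ≤ N := by exact_mod_cast hN
      linarith
    have hNp : (0:ℝ) < (N:ℝ) + 1 := by positivity
    set i := ⌈((v:ℝ) - t) / h * (N + 1)⌉₊ with hi
    have hnn : 0 ≤ ((v:ℝ) - t) / h * (N + 1) := by
      apply mul_nonneg (div_nonneg (by linarith) hh'.le) hNp.le
    have hi1 : ((v:ℝ) - t) / h * (N + 1) ≤ i := Nat.le_ceil _
    have hi2 : (i:ℝ) < ((v:ℝ) - t) / h * (N + 1) + 1 := Nat.ceil_lt_add_one hnn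
    have hg : ((aux_grid t h N i : ℝ≥0) : ℝ) = t + h * (i / (N + 1)) := by
      simp [aux_grid]
    have hg1 : (v:ℝ) ≤ (aux_grid t h N i : ℝ≥0) := by
      rw [hg]
      have : ((v:ℝ) - t) / h ≤ i / (N+1) := by rw [le_div_iff₀ hNp]; exact hi1
      rw [div_le_iff₀ hh'] at this
      linarith
    have hg2 : ((aux_grid t h N i : ℝ≥0) : ℝ) < u' := by
      rw [hg]
      have h3 : (i:ℝ) / (N+1) < ((v:ℝ) - t) / h + 1 / (N+1) := by
        rw [div_lt_iff₀ hNp, add_mul, div_mul_cancel₀ _ hNp.ne']; exact hi2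
      have h4 : (h:ℝ) * (i / (N+1)) < h * (((v:ℝ) - t) / h + 1 / (N+1)) :=
        mul_lt_mul_of_pos_left h3 hh'
      rw [mul_add, mul_div_cancel₀ _ hh'.ne', mul_one_div] at h4
      rw [div_lt_comm₀ (by linarith) hNp] at hN1
      linarith
    have hg1' : v ≤ aux_grid t h N i := by exact_mod_cast hg1
    have hg2' : aux_grid t h N i < u' := by exact_mod_cast hg2
    refine red N i ?_ (hsub ⟨hg1', hg2'.trans_le (min_le_left _ _)⟩)
      (hg2'.trans_le ((min_le_right _ _).trans (min_le_left _ _)))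
    by_contra hcon
    have := aux_grid_mono t h N (le_of_not_ge hcon)
    rw [aux_grid_last] at this
    exact absurd (hg2'.trans_le ((min_le_right _ _).trans (min_le_right _ _))) (not_lt.2 this)

lemma aux_path {Ω : Type*} (Y : ℝ≥0 → Ω → ℝ) (ω : Ω)
    (hY : ∀ v, Tendsto (fun s => Y s ω) (nhdsWithin v (Set.Ici v)) (nhds (Y v ω)))
    (hY0 : ∀ v, 0 ≤ Y v ω)
    (I st : ℝ≥0 → ℝ) (r c₁ c₂ a J L : ℝ) (hr : 1 < r) (hc₁ : 0 < c₁) (hc₂ : 0 < c₂) (ha : 0 < a)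
    (hJ : 0 ≤ J) (hL : 0 < L)
    (hI : ∀ u v (B : ℝ), u ≤ v → 0 ≤ B → (∀ w, u < w → w < v → Y w ω ≤ B) →
      I v - I u ≤ B ^ (r - 1) * ((v:ℝ) - u))
    (hst : ∀ u v, u ≤ v → st v - st u ≤ (v:ℝ) - u)
    (t h : ℝ≥0) (hh : 0 < h)
    (hend : Y (t + h) ω ≤ L → Y (t + h) ω ≤ a + J)
    (V : ℝ≥0 → ℝ)
    (hV : ∀ v, V v = L ^ (1 - r) * (Y v ω ^ r - c₂ * I v) - (Y v ω + c₁ * st v)) :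
    ∀ η > 0, ∀ᶠ N in atTop,
      Y t ω - L ^ (1 - r) * Y t ω ^ r - c₂ * h - c₁ * h - a - J - η ≤
      V (aux_grid t h N (hittingBtwn (fun i ω => Y (aux_grid t h N i) ω) (Ioi L) 0 (N+1) ω))
        - V t := by
  intro η hη
  have hκ : 0 < L ^ (1 - r) := Real.rpow_pos_of_pos hL _
  have hκL : L ^ (1 - r) * L ^ (r - 1) = 1 := by
    rw [← Real.rpow_add hL]; simp
  have hh' : (0:ℝ) < h := by exact_mod_cast hh
  by_cases hne : ({v | t ≤ v ∧ v ≤ t + h ∧ L < Y v ω} : Set ℝ≥0).Nonempty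
  · set S : Set ℝ≥0 := {v | t ≤ v ∧ v ≤ t + h ∧ L < Y v ω} with hS
    set τ := sInf S with hτ
    have hbd : BddBelow S := OrderBot.bddBelow S
    have htτ : t ≤ τ := le_csInf hne fun v hv => hv.1
    have hτh : τ ≤ t + h := by
      obtain ⟨v, hv⟩ := hne
      exact (csInf_le hbd hv).trans hv.2.1
    have hbefore : ∀ w, t < w → w < τ → Y w ω ≤ L := by
      intro w h1 h2
      by_contra hcon
      exact absurd (csInf_le hbd (show w ∈ S from ⟨h1.le, h2.le.trans hτh, not_le.1 hcon⟩))
        (not_le.2 h2)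
    set B := Y τ ω + 1 with hB
    have hB0 : 0 ≤ B := by linarith [hY0 τ]
    have hev := (hY τ).eventually (gt_mem_nhds (show Y τ ω < B by linarith))
    obtain ⟨u, hu, hsub⟩ := mem_nhdsGE_iff_exists_Ico_subset.1 hev
    have hu : τ < u := hu
    set q := L ^ (1 - r) * c₂ * B ^ (r - 1) with hq
    have hq0 : 0 ≤ q := by positivity
    let η' : ℝ≥0 := min (u - τ) (Real.toNNReal (η / (q + 1)))
    have hη' : 0 < η' := lt_min (tsub_pos_of_lt hu) (by rw [Real.toNNReal_pos]; positivity)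
    have hη1 : q * (η' : ℝ) ≤ η := by
      have h1 : (η':ℝ) ≤ η / (q + 1) := by
        have : η' ≤ Real.toNNReal (η / (q + 1)) := min_le_right _ _
        rw [← Real.coe_toNNReal (η / (q+1)) (by positivity)]
        exact_mod_cast this
      rw [le_div_iff₀ (by positivity)] at h1
      have : (0:ℝ) ≤ η' := η'.2
      nlinarith
    filter_upwards [aux_hit Y ω hY t h hh L S rfl hne η' hη'] with N hN
    obtain ⟨k, hk, hk1, hk2, hk3⟩ := hN
    rw [hk]
    set g := aux_grid t h N k with hg
    have hgu : g < u := hk3.trans_le (by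
      have : η' ≤ u - τ := min_le_left _ _
      calc τ + η' ≤ τ + (u - τ) := by gcongr
        _ = u := add_tsub_cancel_of_le hu.le)
    have hgh : (g:ℝ) ≤ t + h := by
      have : g ≤ t + h := by
        rw [← aux_grid_last t h N]
        apply aux_grid_mono
        rw [← hk]; exact hittingBtwn_le ω
      exact_mod_cast this
    have e1 := hI t τ L htτ hL.le hbefore
    have e2 := hI τ g B hk2 hB0 (fun w h1 h2 => (show Y w ω < B from hsub ⟨h1.le, h2.trans hgu⟩).le)
    have e3 := hst t g (htτ.trans hk2)
    have hτh' : (τ:ℝ) ≤ t + h := by exact_mod_cast hτh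
    have hk3' : (g:ℝ) - τ ≤ η' := by
      have : (g:ℝ) < τ + η' := by exact_mod_cast hk3
      linarith
    have e1' : I τ - I t ≤ L ^ (r-1) * h := e1.trans (by
      have : 0 ≤ L ^ (r-1) := Real.rpow_nonneg hL.le _
      gcongr; linarith)
    have e2' : I g - I τ ≤ B ^ (r-1) * η' := e2.trans (by
      have : 0 ≤ B ^ (r-1) := Real.rpow_nonneg hB0 _
      gcongr)
    have e4 : L ^ (1 - r) * c₂ * (I g - I t) ≤ c₂ * h + η := by
      calc L ^ (1 - r) * c₂ * (I g - I t) ≤ L ^ (1 - r) * c₂ * (L ^ (r-1) * h + B ^ (r-1) * η') := by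
            gcongr; linarith
        _ = (L ^ (1 - r) * L ^ (r-1)) * c₂ * h + q * η' := by rw [hq]; ring
        _ ≤ _ := by rw [hκL]; linarith
    have e5 : Y g ω ≤ L ^ (1 - r) * Y g ω ^ r := by
      have hp : 0 < Y g ω := hL.trans hk1
      have h1 : L ^ (r-1) ≤ Y g ω ^ (r-1) := Real.rpow_le_rpow hL.le hk1.le (by linarith)
      have h2 : Y g ω ^ r = Y g ω ^ (r-1) * Y g ω := by
        rw [← Real.rpow_add_one hp.ne']; simp
      rw [h2, ← mul_assoc]
      have : 1 ≤ L ^ (1 - r) * Y g ω ^ (r-1) := by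
        exact hκL.ge.trans (mul_le_mul_of_nonneg_left h1 hκ.le)
      nlinarith
    have e6 : c₁ * (st g - st t) ≤ c₁ * h := by
      gcongr; linarith
    rw [hV, hV]
    nlinarith
  · have hno : ∀ v, t ≤ v → v ≤ t + h → Y v ω ≤ L := by
      intro v h1 h2
      by_contra hcon
      exact hne ⟨v, h1, h2, not_le.1 hcon⟩
    refine Eventually.of_forall fun N => ?_
    have hk : hittingBtwn (fun i ω => Y (aux_grid t h N i) ω) (Ioi L) 0 (N+1) ω = N + 1 := by
      rw [hittingBtwn_eq_end_iff]
      rintro ⟨j, hj, hj2⟩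
      exfalso
      have h1 : aux_grid t h N j ≤ t + h := by
        rw [← aux_grid_last t h N]; exact aux_grid_mono t h N hj.2
      exact absurd (hno _ (by simp [aux_grid]) h1) (not_le.2 hj2)
    rw [hk, aux_grid_last]
    have e1 := hI t (t+h) L (by simp) hL.le (fun w h1 h2 => hno w h1.le h2.le)
    have e2 := hst t (t+h) (by simp)
    have e3 := hend (hno _ (by simp) le_rfl)
    push_cast at e1 e2
    rw [add_sub_cancel_left] at e1 e2
    have e4 : L ^ (1 - r) * c₂ * (I (t+h) - I t) ≤ c₂ * h := by
      calc L ^ (1 - r) * c₂ * (I (t+h) - I t) ≤ L ^ (1 - r) * c₂ * (L ^ (r-1) * h) := by gcongr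
        _ = (L ^ (1 - r) * L ^ (r-1)) * c₂ * h := by ring
        _ = _ := by rw [hκL]; ring
    have e5 : 0 ≤ L ^ (1 - r) * Y (t+h) ω ^ r := mul_nonneg hκ.le (Real.rpow_nonneg (hY0 _) _)
    have e6 : c₁ * (st (t+h) - st t) ≤ c₁ * h := by gcongr
    rw [hV, hV]
    nlinarith

section hitlemmas
variable {Ω : Type*} (X : ℝ≥0 → Ω → ℝ) (a : ℝ) (ω : Ω)

lemma aux_lt_hit {v : ℝ≥0} (h : (v : ℝ≥0∞) < hitTime X a ω) : a < X v ω := by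
  by_contra hcon
  exact absurd (sInf_le (Set.mem_image_of_mem _ (show v ∈ {s | X s ω ≤ a} from not_lt.1 hcon)))
    (not_le.2 h)

lemma aux_hit_le (hX : RightCts X) (hT : hitTime X a ω ≠ ⊤) : X (hitTime X a ω).toNNReal ω ≤ a := by
  by_contra hcon
  set τ := (hitTime X a ω).toNNReal with hτ
  have hτT : (τ : ℝ≥0∞) = hitTime X a ω := ENNReal.coe_toNNReal hT
  have hev := (hX ω τ).eventually (lt_mem_nhds (not_le.1 hcon))
  obtain ⟨u, hu, hsub⟩ := mem_nhdsGE_iff_exists_Ico_subset.1 hev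
  have hu : τ < u := hu
  have : (u : ℝ≥0∞) ≤ hitTime X a ω := by
    refine le_sInf ?_
    rintro _ ⟨s, hs, rfl⟩
    simp only [ENNReal.coe_le_coe]
    by_contra hlt
    have h1 : (τ : ℝ≥0∞) ≤ s := hτT.le.trans (sInf_le (Set.mem_image_of_mem _ hs))
    exact absurd (show a < X s ω from hsub ⟨by exact_mod_cast h1, not_le.1 hlt⟩) (not_lt.2 hs)
  rw [← hτT] at this
  exact absurd (by exact_mod_cast this) (not_le.2 hu)

lemma aux_stop_of_le {v : ℝ≥0} (h : (v : ℝ≥0∞) ≤ hitTime X a ω) : stopAt X a v ω = v := by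
  simp [stopAt, min_eq_left h]

lemma aux_stop_of_ge {v : ℝ≥0} (h : hitTime X a ω ≤ v) :
    stopAt X a v ω = (hitTime X a ω).toNNReal := by
  simp [stopAt, min_eq_right h]

lemma aux_coe_stop (v : ℝ≥0) : (stopAt X a v ω : ℝ≥0∞) = min (v:ℝ≥0∞) (hitTime X a ω) := by
  unfold stopAt
  rw [ENNReal.coe_toNNReal]
  exact ne_top_of_le_ne_top ENNReal.coe_ne_top (min_le_left _ _)

lemma aux_stop_le (v : ℝ≥0) : stopAt X a v ω ≤ v := by
  rw [← ENNReal.coe_le_coe, aux_coe_stop]; exact min_le_left _ _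

lemma aux_stop_mono {u v : ℝ≥0} (h : u ≤ v) : stopAt X a u ω ≤ stopAt X a v ω := by
  rw [← ENNReal.coe_le_coe, aux_coe_stop, aux_coe_stop]
  exact min_le_min_right _ (by exact_mod_cast h)

lemma aux_stop_sub {u v : ℝ≥0} (h : u ≤ v) :
    ((stopAt X a v ω : ℝ≥0) : ℝ) - (stopAt X a u ω : ℝ≥0) ≤ (v:ℝ) - u := by
  have h' : (u:ℝ) ≤ v := by exact_mod_cast h
  rcases le_total (u:ℝ≥0∞) (hitTime X a ω) with h1 | h1
  · rw [aux_stop_of_le X a ω h1]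
    have : ((stopAt X a v ω : ℝ≥0):ℝ) ≤ v := by exact_mod_cast aux_stop_le X a ω v
    linarith
  · rw [aux_stop_of_ge X a ω h1, aux_stop_of_ge X a ω (h1.trans (by exact_mod_cast h))]
    linarith

lemma aux_lt_iff (hX : RightCts X) (v : ℝ≥0) :
    a < X (stopAt X a v ω) ω ↔ (v:ℝ≥0∞) < hitTime X a ω := by
  constructor
  · intro h
    by_contra hcon
    have hle := not_lt.1 hcon
    rw [aux_stop_of_ge X a ω hle] at h
    exact absurd (aux_hit_le X a ω hX (ne_top_of_le_ne_top ENNReal.coe_ne_top hle)) (not_le.2 h)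
  · intro h
    rw [aux_stop_of_le X a ω h.le]
    exact aux_lt_hit X a ω h

lemma aux_stop_rc (hX : RightCts X) (v : ℝ≥0) :
    Tendsto (fun s => X (stopAt X a s ω) ω) (nhdsWithin v (Set.Ici v))
      (nhds (X (stopAt X a v ω) ω)) := by
  rcases lt_or_ge (v:ℝ≥0∞) (hitTime X a ω) with h | h
  · rw [aux_stop_of_le X a ω h.le]
    refine (hX ω v).congr' ?_
    have hc : Tendsto (fun s : ℝ≥0 => (s:ℝ≥0∞)) (nhdsWithin v (Set.Ici v)) (nhds (v:ℝ≥0∞)) :=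
      (ENNReal.continuous_coe.tendsto v).mono_left nhdsWithin_le_nhds
    filter_upwards [hc.eventually (gt_mem_nhds h)] with s hs
    rw [aux_stop_of_le X a ω hs.le]
  · refine tendsto_const_nhds.congr' ?_
    filter_upwards [self_mem_nhdsWithin] with s hs
    rw [aux_stop_of_ge X a ω h, aux_stop_of_ge X a ω (h.trans (by exact_mod_cast hs))]

lemma aux_int_stop (hX0 : ∀ v, 0 ≤ X v ω) (e B : ℝ) (he : 0 ≤ e) (u v : ℝ≥0) (huv : u ≤ v)
    (hB0 : 0 ≤ B) (hB : ∀ w, u < w → w < v → X (stopAt X a w ω) ω ≤ B) :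
    (∫ s in Set.Ioc (0:ℝ) ((stopAt X a v ω : ℝ≥0) : ℝ), X s.toNNReal ω ^ e)
      - (∫ s in Set.Ioc (0:ℝ) ((stopAt X a u ω : ℝ≥0) : ℝ), X s.toNNReal ω ^ e)
      ≤ B ^ e * ((v:ℝ) - u) := by
  refine (aux_int (fun s => X s ω) hX0 e B he _ _ (aux_stop_mono X a ω huv) ?_ hB0).trans ?_
  · intro w h1 h2
    have hwT : (w:ℝ≥0∞) < hitTime X a ω := by
      have : (w:ℝ≥0∞) < stopAt X a v ω := by exact_mod_cast h2
      rw [aux_coe_stop] at this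
      exact this.trans_le (min_le_right _ _)
    have huw : u < w := by
      by_contra hcon
      have := aux_stop_mono X a ω (not_lt.1 hcon)
      rw [aux_stop_of_le X a ω hwT.le] at this
      exact absurd h1 (not_lt.2 this)
    have := hB w huw (h2.trans_le (aux_stop_le X a ω v))
    rwa [aux_stop_of_le X a ω hwT.le] at this
  · have := Real.rpow_nonneg hB0 e
    gcongr ?_ * ?_
    exact aux_stop_sub X a ω huv

end hitlemmas

lemma aux_key {Ω : Type*} {m : MeasurableSpace Ω}
    (𝒢 : MeasureTheory.Filtration ℝ≥0 m) (ℙ : Measure Ω) [IsProbabilityMeasure ℙ]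
    (X : ℝ≥0 → Ω → ℝ)
    (hXnn : ∀ t ω, 0 ≤ X t ω) (hXrc : RightCts X)
    (a c₁ c₂ r : ℝ) (ha : 0 < a) (hc₁ : 0 < c₁) (hc₂ : 0 < c₂) (hr : 1 < r)
    (hsub : MeasureTheory.Submartingale
      (fun (t : ℝ≥0) (ω : Ω) => X (stopAt X a t ω) ω + c₁ * ((stopAt X a t ω : ℝ≥0) : ℝ)) 𝒢 ℙ)
    (hsup : MeasureTheory.Supermartingale
      (fun (t : ℝ≥0) (ω : Ω) => X (stopAt X a t ω) ω ^ r
        - c₂ * ∫ s in Set.Ioc (0:ℝ) ((stopAt X a t ω : ℝ≥0) : ℝ), X s.toNNReal ω ^ (r - 1)) 𝒢 ℙ)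
    (hY : Adapted 𝒢 (fun (t : ℝ≥0) (ω : Ω) => X (stopAt X a t ω) ω))
    (M y : ℝ) (hM : 0 < M) (hM4 : 2 ^ r * M ^ (1 - r) ≤ 1 / 4)
    (h : ℝ≥0) (hh : 0 < h) (hh4 : (c₁ + c₂) * h ≤ y / 4)
    (hy : 4 * a ≤ y) (t : ℝ≥0) :
    ℙ.real {ω | y ≤ X (stopAt X a t ω) ω ∧ X (stopAt X a t ω) ω < 2 * y} ≤ 4 * M *
      ℙ.real ({ω | y ≤ X (stopAt X a t ω) ω ∧ X (stopAt X a t ω) ω < 2 * y} ∩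
        {ω | ((t + h : ℝ≥0) : ℝ≥0∞) < hitTime X a ω}) := by
  set Y : ℝ≥0 → Ω → ℝ := fun t ω => X (stopAt X a t ω) ω with hYdef
  set A : Set Ω := {ω | y ≤ Y t ω ∧ Y t ω < 2 * y} with hAdef
  set S : Set Ω := {ω | ((t + h : ℝ≥0) : ℝ≥0∞) < hitTime X a ω} with hSdef
  have hy0 : 0 < y := by linarith
  have hL : 0 < M * y := by positivity
  have hA : MeasurableSet[𝒢 t] A :=
    (measurableSet_le measurable_const (hY t)).inter (measurableSet_lt (hY t) measurable_const)
  have hAm : MeasurableSet A := 𝒢.le _ _ hA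
  have hSm : MeasurableSet S := by
    have : S = {ω | a < Y (t+h) ω} := by
      ext ω; exact (aux_lt_iff X a ω hXrc (t+h)).symm
    rw [this]
    exact 𝒢.le (t+h) _ (measurableSet_lt measurable_const (hY (t+h)))
  set κ := (M * y) ^ (1 - r) with hκdef
  have hκ : 0 < κ := Real.rpow_pos_of_pos hL _
  set V : ℝ≥0 → Ω → ℝ := fun v ω => κ * (Y v ω ^ r
        - c₂ * ∫ s in Set.Ioc (0:ℝ) ((stopAt X a v ω : ℝ≥0) : ℝ), X s.toNNReal ω ^ (r - 1))
        - (Y v ω + c₁ * ((stopAt X a v ω : ℝ≥0) : ℝ)) with hVdef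
  have hV : Supermartingale V 𝒢 ℙ := (hsup.smul_nonneg hκ.le).sub_submartingale hsub
  set C0 : ℝ := y - κ * (2 * y) ^ r - c₂ * h - c₁ * h - a with hC0
  have hκ2 : κ * (2 * y) ^ r ≤ y / 4 := by
    have : κ * (2 * y) ^ r = (2 ^ r * M ^ (1 - r)) * y := by
      rw [hκdef, Real.mul_rpow hM.le hy0.le, Real.mul_rpow (by norm_num) hy0.le]
      have : y ^ (1 - r) * y ^ r = y := by
        rw [← Real.rpow_add hy0]; simp
      calc _ = 2 ^ r * M ^ (1 - r) * (y ^ (1 - r) * y ^ r) := by ring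
        _ = _ := by rw [this]
    rw [this]
    nlinarith
  have hC0y : y / 4 ≤ C0 := by
    rw [hC0]; nlinarith
  set G : Ω → ℝ := fun ω => C0 - S.indicator (fun _ => M * y) ω with hG
  have hGm : Measurable G := measurable_const.sub (measurable_const.indicator hSm)
  have hmain : ∫ ω in A, G ω ∂ℙ ≤ 0 := by
    refine aux_FS (ℙ.restrict A)
      (fun N ω => V (aux_grid t h N (hittingBtwn (fun i ω => Y (aux_grid t h N i) ω)
        (Ioi (M * y)) 0 (N+1) ω)) ω - V t ω)
      (fun ω => V (t+h) ω - V t ω) G (|C0| + M * y)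
      (fun N => (aux_OS 𝒢 ℙ V Y hV hY t h A hA (M*y) N).1)
      (fun N => (aux_OS 𝒢 ℙ V Y hV hY t h A hA (M*y) N).2.1)
      ((hV.integrable _).sub (hV.integrable _)).restrict
      (fun N => (aux_OS 𝒢 ℙ V Y hV hY t h A hA (M*y) N).2.2) hGm ?_ ?_
    · intro ω
      refine (abs_sub _ _).trans ?_
      gcongr
      by_cases hω : ω ∈ S
      · simp [hω, abs_of_pos hM, abs_of_pos hy0]
      · simp [hω, hL.le]
    · filter_upwards [ae_restrict_mem hAm] with ω hω
      intro η hη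
      have hind : 0 ≤ S.indicator (fun _ => M * y) ω :=
        Set.indicator_nonneg (fun _ _ => hL.le) _
      have := aux_path Y ω (fun v => aux_stop_rc X a ω hXrc v) (fun v => hXnn _ _)
        (fun v => ∫ s in Set.Ioc (0:ℝ) ((stopAt X a v ω : ℝ≥0) : ℝ), X s.toNNReal ω ^ (r - 1))
        (fun v => ((stopAt X a v ω : ℝ≥0) : ℝ)) r c₁ c₂ a (S.indicator (fun _ => M * y) ω) (M * y)
        hr hc₁ hc₂ ha hind hL
        (fun u v B huv hB0 hB => aux_int_stop X a ω (fun v => hXnn v ω) (r-1) B (by linarith) u v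
          huv hB0 hB)
        (fun u v huv => aux_stop_sub X a ω huv) t h hh ?_ (fun v => V v ω) (fun v => rfl) η hη
      · filter_upwards [this] with N hN
        refine le_trans ?_ hN
        have h1 : Y t ω ^ r ≤ (2 * y) ^ r :=
          Real.rpow_le_rpow (hXnn _ _) hω.2.le (by linarith)
        have h2 : κ * Y t ω ^ r ≤ κ * (2 * y) ^ r := by gcongr
        have h3 := hω.1
        simp only [hG, hC0]
        linarith
      · intro hle
        by_cases hωS : ω ∈ S
        · rw [Set.indicator_of_mem hωS]; linarith
        · rw [Set.indicator_of_notMem hωS, add_zero]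
          by_contra hcon
          exact hωS ((aux_lt_iff X a ω hXrc (t+h)).1 (not_le.1 hcon))
  have hcalc : ∫ ω in A, G ω ∂ℙ = C0 * ℙ.real A - M * y * ℙ.real (A ∩ S) := by
    rw [hG, integral_sub (integrable_const _) ((integrable_const _).indicator hSm),
      setIntegral_indicator hSm]
    simp
    ring
  rw [hcalc] at hmain
  have hA0 : 0 ≤ ℙ.real A := measureReal_nonneg
  have : y / 4 * ℙ.real A ≤ M * y * ℙ.real (A ∩ S) := by nlinarith
  have h2 : y * ℙ.real A ≤ y * (4 * M * ℙ.real (A ∩ S)) := by linarith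
  exact le_of_mul_le_mul_left h2 hy0

lemma aux_moment {Ω : Type*} {m : MeasurableSpace Ω} (ℙ : Measure Ω) [IsProbabilityMeasure ℙ]
    (Z : Ω → ℝ) (hZ : Measurable Z) (T : Ω → ℝ≥0∞) (t : ℝ≥0)
    (a M ε q : ℝ) (ha : 0 < a) (hM : 0 < M) (hε : 0 < ε) (hq : 0 < q)
    (hT : ∀ h : ℝ≥0, MeasurableSet {ω | ((t + h : ℝ≥0) : ℝ≥0∞) < T ω})
    (hkey : ∀ y, 4 * a ≤ y → ∀ h : ℝ≥0, (h:ℝ) = ε * y →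
      ℙ.real {ω | y ≤ Z ω ∧ Z ω < 2 * y} ≤ 4 * M *
      ℙ.real ({ω | y ≤ Z ω ∧ Z ω < 2 * y} ∩ {ω | ((t + h : ℝ≥0) : ℝ≥0∞) < T ω})) :
    ENNReal.ofReal ((ε / 2) ^ q / (4 * M)) * ∫⁻ ω in {ω | 4 * a ≤ Z ω}, ENNReal.ofReal (Z ω ^ q) ∂ℙ
      ≤ ∫⁻ ω, T ω ^ q ∂ℙ := by
  let yy : ℕ → ℝ := fun k => 4 * a * 2 ^ k
  let A : ℕ → Set Ω := fun k => {ω | yy k ≤ Z ω ∧ Z ω < 2 * yy k}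
  have hy0 : ∀ k, 0 < yy k := fun k => by positivity
  have hy4 : ∀ k, 4 * a ≤ yy k := fun k =>
    le_mul_of_one_le_right (by positivity) (one_le_pow₀ (by norm_num))
  have hAm : ∀ k, MeasurableSet (A k) := fun k =>
    (measurableSet_le measurable_const hZ).inter (measurableSet_lt hZ measurable_const)
  have hU : {ω | 4 * a ≤ Z ω} ⊆ ⋃ k, A k := by
    intro ω hω
    have hω : 4 * a ≤ Z ω := hω
    have h1 : 1 ≤ Z ω / (4 * a) := by rw [le_div_iff₀ (by positivity)]; linarith
    obtain ⟨k, hk1, hk2⟩ := exists_nat_pow_near h1 (show (1:ℝ) < 2 by norm_num)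
    rw [le_div_iff₀ (by positivity)] at hk1
    rw [div_lt_iff₀ (by positivity)] at hk2
    refine Set.mem_iUnion.2 ⟨k, ?_, ?_⟩
    · change 4 * a * 2 ^ k ≤ Z ω; linarith
    · change Z ω < 2 * (4 * a * 2 ^ k); rw [pow_succ] at hk2; linarith
  have hdisj : Pairwise (Function.onFun Disjoint A) := by
    have hlt : ∀ i j, i < j → Disjoint (A i) (A j) := by
      intro i j hij
      rw [Set.disjoint_left]
      rintro ω ⟨_, h1⟩ ⟨h2, _⟩
      have : (2:ℝ) ^ (i+1) ≤ 2 ^ j := pow_le_pow_right₀ (by norm_num) hij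
      have h3 : 2 * yy i ≤ yy j := by
        calc 2 * yy i = 4 * a * 2 ^ (i+1) := by simp only [yy]; ring
          _ ≤ 4 * a * 2 ^ j := by gcongr
      linarith
    intro i j hij
    rcases lt_or_gt_of_ne hij with h | h
    · exact hlt i j h
    · exact (hlt j i h).symm
  have hstep : ∀ k, ENNReal.ofReal ((ε / 2) ^ q / (4 * M)) * ∫⁻ ω in A k, ENNReal.ofReal (Z ω ^ q) ∂ℙ
      ≤ ∫⁻ ω in A k, T ω ^ q ∂ℙ := by
    intro k
    have hεy : 0 < ε * yy k := mul_pos hε (hy0 k)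
    let h : ℝ≥0 := ⟨ε * yy k, hεy.le⟩
    have hk := hkey (yy k) (hy4 k) h rfl
    have e1 : ∫⁻ ω in A k, ENNReal.ofReal (Z ω ^ q) ∂ℙ
        ≤ ENNReal.ofReal ((2 * yy k) ^ q) * ℙ (A k) := by
      rw [← setLIntegral_const]
      refine setLIntegral_mono measurable_const fun ω hω => ?_
      exact ENNReal.ofReal_le_ofReal
        (Real.rpow_le_rpow ((hy0 k).le.trans hω.1) hω.2.le hq.le)
    have e2 : ENNReal.ofReal ((ε * yy k) ^ q) *
        ℙ (A k ∩ {ω | ((t + h : ℝ≥0) : ℝ≥0∞) < T ω}) ≤ ∫⁻ ω in A k, T ω ^ q ∂ℙ := by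
      rw [← setLIntegral_const]
      refine (setLIntegral_mono' ((hAm k).inter (hT h)) ?_).trans
        (lintegral_mono_set Set.inter_subset_left)
      intro ω hω
      rw [← ENNReal.ofReal_rpow_of_nonneg hεy.le hq.le]
      refine ENNReal.rpow_le_rpow ?_ hq.le
      have h1 : ENNReal.ofReal (ε * yy k) = (h : ℝ≥0∞) := ENNReal.ofReal_eq_coe_nnreal hεy.le
      rw [h1]
      have h2 : (h : ℝ≥0∞) ≤ ((t + h : ℝ≥0) : ℝ≥0∞) := by
        rw [ENNReal.coe_le_coe]; simp
      exact h2.trans hω.2.le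
    refine le_trans ?_ e2
    refine (mul_le_mul_right e1 _).trans ?_
    rw [← ofReal_measureReal, ← ofReal_measureReal, ← ENNReal.ofReal_mul (by positivity),
      ← ENNReal.ofReal_mul (by positivity), ← ENNReal.ofReal_mul (by positivity)]
    refine ENNReal.ofReal_le_ofReal ?_
    have e3 : (ε * yy k) ^ q = (ε / 2) ^ q * (2 * yy k) ^ q := by
      rw [← Real.mul_rpow (by positivity) (by have := hy0 k; positivity)]; congr 1; ring
    have hyk := hy0 k
    rw [e3]
    calc (ε / 2) ^ q / (4 * M) * ((2 * yy k) ^ q * ℙ.real (A k))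
        = ((ε / 2) ^ q * (2 * yy k) ^ q) * (ℙ.real (A k) / (4 * M)) := by ring
      _ ≤ _ := by
        gcongr
        rw [div_le_iff₀ (by positivity)]
        linarith
  calc _ ≤ ENNReal.ofReal ((ε / 2) ^ q / (4 * M)) *
        ∑' k, ∫⁻ ω in A k, ENNReal.ofReal (Z ω ^ q) ∂ℙ := by
        gcongr
        exact (lintegral_mono_set hU).trans (lintegral_iUnion_le _ _)
    _ = ∑' k, ENNReal.ofReal ((ε / 2) ^ q / (4 * M)) * ∫⁻ ω in A k, ENNReal.ofReal (Z ω ^ q) ∂ℙ :=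
        ENNReal.tsum_mul_left.symm
    _ ≤ ∑' k, ∫⁻ ω in A k, T ω ^ q ∂ℙ := ENNReal.tsum_le_tsum hstep
    _ = ∫⁻ ω in ⋃ k, A k, T ω ^ q ∂ℙ := (lintegral_iUnion hAm hdisj _).symm
    _ ≤ _ := setLIntegral_le_lintegral _ _

/-- Corollary: if a nonnegative adapted process `X` starts at `x > a`,
satisfies the drift bounds `E(dX_t|𝒢_{t-}) ≥ -c₁ dt` and
`E(dX_t^r|𝒢_{t-}) ≤ c₂ X_{t-}^{r-1} dt` before the hitting time `T_a` of
`[0,a]`, and `(X_{t∧T_a}^p)` is a submartingale, then `E(T_a^q) = ∞` for all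
`q > p`. -/
theorem statement18 {Ω : Type*} {m : MeasurableSpace Ω}
    (𝒢 : MeasureTheory.Filtration ℝ≥0 m) (ℙ : Measure Ω) [IsProbabilityMeasure ℙ]
    (X : ℝ≥0 → Ω → ℝ) (hXad : MeasureTheory.Adapted 𝒢 X)
    (hXnn : ∀ t ω, 0 ≤ X t ω) (hXrc : RightCts X)
    (a c₁ c₂ p r x : ℝ) (ha : 0 < a) (hc₁ : 0 < c₁) (hc₂ : 0 < c₂)
    (hp : 0 < p) (hr : 1 < r)
    (hx : a < x) (hX0 : ∀ᵐ ω ∂ℙ, X 0 ω = x)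
    (hsub : MeasureTheory.Submartingale
      (fun (t : ℝ≥0) (ω : Ω) => X (stopAt X a t ω) ω + c₁ * ((stopAt X a t ω : ℝ≥0) : ℝ)) 𝒢 ℙ)
    (hsup : MeasureTheory.Supermartingale
      (fun (t : ℝ≥0) (ω : Ω) => X (stopAt X a t ω) ω ^ r
        - c₂ * ∫ s in Set.Ioc (0:ℝ) ((stopAt X a t ω : ℝ≥0) : ℝ), X s.toNNReal ω ^ (r - 1)) 𝒢 ℙ)
    (hsubp : MeasureTheory.Submartingale
      (fun (t : ℝ≥0) (ω : Ω) => X (stopAt X a t ω) ω ^ p) 𝒢 ℙ) :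
    ∀ q : ℝ, p < q → ∫⁻ ω, hitTime X a ω ^ q ∂ℙ = ⊤ := by
  intro q hpq
  by_contra hfin
  have hq : 0 < q := hp.trans hpq
  set Y : ℝ≥0 → Ω → ℝ := fun t ω => X (stopAt X a t ω) ω with hYdef
  have hY0 : ∀ t ω, 0 ≤ Y t ω := fun t ω => hXnn _ _
  have hY : Adapted 𝒢 Y := by
    intro t
    have h1 : Measurable[𝒢 t] (fun ω => (Y t ω ^ p) ^ (1 / p)) :=
      (hsubp.1 t).measurable.pow_const (1 / p)
    have h2 : (fun ω => (Y t ω ^ p) ^ (1 / p)) = Y t := by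
      ext ω
      rw [← Real.rpow_mul (hY0 t ω), mul_one_div_cancel hp.ne', Real.rpow_one]
    rwa [h2] at h1
  have hYm : ∀ t, Measurable (Y t) := fun t => (hY t).mono (𝒢.le t) le_rfl
  have hTm : ∀ t : ℝ≥0, MeasurableSet {ω | (t : ℝ≥0∞) < hitTime X a ω} := by
    intro t
    have : {ω | (t : ℝ≥0∞) < hitTime X a ω} = {ω | a < Y t ω} := by
      ext ω; exact (aux_lt_iff X a ω hXrc t).symm
    rw [this]
    exact measurableSet_lt measurable_const (hYm t)
  -- constants
  obtain ⟨M, hM, hM4⟩ : ∃ M : ℝ, 0 < M ∧ 2 ^ r * M ^ (1 - r) ≤ 1 / 4 := by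
    have h1 : Tendsto (fun M : ℝ => 2 ^ r * M ^ (1 - r)) atTop (nhds (2 ^ r * 0)) := by
      have := (tendsto_rpow_neg_atTop (show 0 < r - 1 by linarith)).const_mul ((2:ℝ) ^ r)
      simpa only [neg_sub] using this
    rw [mul_zero] at h1
    obtain ⟨M, hM⟩ := ((h1.eventually (ge_mem_nhds (show (0:ℝ) < 1/4 by norm_num))).and
      (eventually_gt_atTop 0)).exists
    exact ⟨M, hM.2, hM.1⟩
  set ε : ℝ := 1 / (4 * (c₁ + c₂)) with hεdef
  have hε : 0 < ε := by positivity
  set c : ℝ := (ε / 2) ^ q / (4 * M) with hcdef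
  have hc : 0 < c := by positivity
  set Q : ℝ := (∫⁻ ω, hitTime X a ω ^ q ∂ℙ).toReal with hQ
  have hQe : ∫⁻ ω, hitTime X a ω ^ q ∂ℙ = ENNReal.ofReal Q := (ENNReal.ofReal_toReal hfin).symm
  have hQ0 : 0 ≤ Q := ENNReal.toReal_nonneg
  have hmom : ∀ t : ℝ≥0, ∫⁻ ω in {ω | 4 * a ≤ Y t ω}, ENNReal.ofReal (Y t ω ^ q) ∂ℙ
      ≤ ENNReal.ofReal (Q / c) := by
    intro t
    have := aux_moment ℙ (Y t) (hYm t) (hitTime X a) t a M ε q ha hM hε hq (fun h => hTm (t + h)) (by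
      intro y hy h hh
      have hy0 : 0 < y := by linarith
      refine aux_key 𝒢 ℙ X hXnn hXrc a c₁ c₂ r ha hc₁ hc₂ hr hsub hsup hY M y hM hM4 h ?_ ?_ hy t
      · rw [← NNReal.coe_pos, hh]; positivity
      · rw [hh, hεdef]; apply le_of_eq; field_simp)
    rw [hQe] at this
    rw [ENNReal.ofReal_div_of_pos hc]
    rw [ENNReal.le_div_iff_mul_le (Or.inl (by simpa using hc)) (Or.inl ENNReal.ofReal_ne_top),
      mul_comm]
    exact this
  have htail : ∀ t : ℝ≥0, 0 < t → ℙ {ω | (t : ℝ≥0∞) < hitTime X a ω}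
      ≤ ENNReal.ofReal (Q / (t:ℝ) ^ q) := by
    intro t ht
    have ht' : (0:ℝ) < t := by exact_mod_cast ht
    have hpos : 0 < (t:ℝ) ^ q := by positivity
    rw [ENNReal.ofReal_div_of_pos hpos,
      ENNReal.le_div_iff_mul_le (Or.inl (by simpa using hpos)) (Or.inl ENNReal.ofReal_ne_top),
      mul_comm, ← hQe, ← setLIntegral_const]
    refine (setLIntegral_mono' (hTm t) ?_).trans (setLIntegral_le_lintegral _ _)
    intro ω hω
    rw [← ENNReal.ofReal_rpow_of_nonneg (NNReal.coe_nonneg t) hq.le]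
    refine ENNReal.rpow_le_rpow ?_ hq.le
    rw [ENNReal.ofReal_coe_nnreal]
    exact le_of_lt hω
  have hx0 : 0 < x := ha.trans hx
  have hmain : ∀ (t : ℝ≥0) (K : ℝ), 0 < t → 4 * a ≤ K →
      x ^ p ≤ a ^ p + K ^ p * (Q / (t:ℝ) ^ q) + K ^ (p - q) * (Q / c) := by
    intro t K ht hK
    have hK0 : 0 < K := by linarith
    have ht' : (0:ℝ) < t := by exact_mod_cast ht
    have h1 : x ^ p ≤ ∫ ω, Y t ω ^ p ∂ℙ := by
      have h2 := hsubp.setIntegral_le (show (0:ℝ≥0) ≤ t from bot_le) MeasurableSet.univ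
      rw [setIntegral_univ, setIntegral_univ] at h2
      refine le_trans (le_of_eq ?_) h2
      have : ∫ ω, X (stopAt X a 0 ω) ω ^ p ∂ℙ = ∫ _, x ^ p ∂ℙ := by
        refine integral_congr_ae ?_
        filter_upwards [hX0] with ω hω
        have : stopAt X a 0 ω = 0 := le_antisymm (aux_stop_le X a ω 0) bot_le
        rw [this, hω]
      rw [this]; simp
    have h3 : ENNReal.ofReal (∫ ω, Y t ω ^ p ∂ℙ) = ∫⁻ ω, ENNReal.ofReal (Y t ω ^ p) ∂ℙ :=
      ofReal_integral_eq_lintegral_ofReal (hsubp.integrable t)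
        (Eventually.of_forall fun ω => Real.rpow_nonneg (hY0 t ω) _)
    have hBm : MeasurableSet {ω | 4 * a ≤ Y t ω} := measurableSet_le measurable_const (hYm t)
    have h4 : ∫⁻ ω, ENNReal.ofReal (Y t ω ^ p) ∂ℙ ≤ ∫⁻ ω, (ENNReal.ofReal (a ^ p)
        + {ω | (t : ℝ≥0∞) < hitTime X a ω}.indicator (fun _ => ENNReal.ofReal (K ^ p)) ω
        + {ω | 4 * a ≤ Y t ω}.indicator
          (fun ω => ENNReal.ofReal (K ^ (p - q)) * ENNReal.ofReal (Y t ω ^ q)) ω) ∂ℙ := by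
      refine lintegral_mono fun ω => ?_
      rcases le_or_gt (Y t ω) a with hya | hya
      · refine le_trans ?_ (le_add_right (le_add_right le_rfl))
        exact ENNReal.ofReal_le_ofReal (Real.rpow_le_rpow (hY0 t ω) hya hp.le)
      · rcases le_or_gt (Y t ω) K with hyK | hyK
        · refine le_trans ?_ (le_add_right (le_add_left le_rfl))
          rw [Set.indicator_of_mem (show ω ∈ {ω | (t : ℝ≥0∞) < hitTime X a ω} from
            (aux_lt_iff X a ω hXrc t).1 hya)]
          exact ENNReal.ofReal_le_ofReal (Real.rpow_le_rpow (hY0 t ω) hyK hp.le)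
        · refine le_trans ?_ (le_add_left le_rfl)
          rw [Set.indicator_of_mem (show ω ∈ {ω | 4 * a ≤ Y t ω} from hK.trans hyK.le),
            ← ENNReal.ofReal_mul (by positivity)]
          refine ENNReal.ofReal_le_ofReal ?_
          have hyp : 0 < Y t ω := hK0.trans hyK
          have h5 : Y t ω ^ p = Y t ω ^ (p - q) * Y t ω ^ q := by
            rw [← Real.rpow_add hyp]; simp
          rw [h5]
          refine mul_le_mul_of_nonneg_right ?_ (by positivity)
          exact Real.rpow_le_rpow_of_nonpos hK0 hyK.le (by linarith)
    have hm1 : Measurable (fun ω => ENNReal.ofReal (a ^ p)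
        + {ω | (t : ℝ≥0∞) < hitTime X a ω}.indicator (fun _ => ENNReal.ofReal (K ^ p)) ω) :=
      (measurable_const.indicator (hTm t)).const_add _
    rw [lintegral_add_left hm1,
      lintegral_add_left measurable_const, lintegral_const, lintegral_indicator_const (hTm t),
      lintegral_indicator hBm, lintegral_const_mul' _ _ ENNReal.ofReal_ne_top, measure_univ,
      mul_one] at h4
    have h6 : ENNReal.ofReal (x ^ p) ≤
        ENNReal.ofReal (a ^ p + K ^ p * (Q / (t:ℝ) ^ q) + K ^ (p - q) * (Q / c)) := by
      rw [ENNReal.ofReal_add (by positivity) (by positivity),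
        ENNReal.ofReal_add (by positivity) (by positivity), ENNReal.ofReal_mul (by positivity),
        ENNReal.ofReal_mul (by positivity)]
      refine (ENNReal.ofReal_le_ofReal h1).trans (h3.le.trans (h4.trans ?_))
      gcongr
      · exact htail t ht
      · exact hmom t
    exact (ENNReal.ofReal_le_ofReal_iff (by positivity)).1 h6
  -- let `t → ∞`
  have hmain2 : ∀ K : ℝ, 4 * a ≤ K → x ^ p ≤ a ^ p + K ^ (p - q) * (Q / c) := by
    intro K hK
    have hl : Tendsto (fun s : ℝ => a ^ p + K ^ p * (Q / s ^ q) + K ^ (p - q) * (Q / c)) atTop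
        (nhds (a ^ p + K ^ p * 0 + K ^ (p - q) * (Q / c))) := by
      refine Tendsto.add_const _ (Tendsto.const_add _ (Tendsto.const_mul _ ?_))
      exact tendsto_const_nhds.div_atTop (tendsto_rpow_atTop hq)
    rw [mul_zero, add_zero] at hl
    refine ge_of_tendsto hl ?_
    filter_upwards [eventually_gt_atTop 0] with s hs
    exact hmain ⟨s, hs.le⟩ K hs hK
  have hl : Tendsto (fun K : ℝ => a ^ p + K ^ (p - q) * (Q / c)) atTop
      (nhds (a ^ p + 0 * (Q / c))) := by
    refine Tendsto.const_add _ (Tendsto.mul_const _ ?_)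
    simpa only [neg_sub] using tendsto_rpow_neg_atTop (show 0 < q - p by linarith)
  rw [zero_mul, add_zero] at hl
  have hfinal : x ^ p ≤ a ^ p := by
    refine ge_of_tendsto hl ?_
    filter_upwards [eventually_ge_atTop (4 * a)] with K hK
    exact hmain2 K hK
  exact absurd hfinal (not_le.2 (Real.rpow_lt_rpow ha.le hx hp))
end
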